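/- arXiv:1407.1100 — 4 statements merged into one kernel-verified Lean document; each statement's English description precedes it below -/
import Mathlib

section
/- Let S, T ⊆ E × E* be closed, monotone and quasidense sets. Suppose that ⋃_{λ > 0} λ·(π₁ dom φ_S − π₁ dom φ_T) is a closed linear subspace of E, where π₁ dom φ_S := { x ∈ E : φ_S(x, x*) < ∞ for some x* ∈ E* } (this hypothesis holds, in particular, whenever ⋃_{λ > 0} λ·(π₁S − π₁T) = E). Then the sum S + T := { (x, s* + t*) : (x, s*) ∈ S and (x, t*) ∈ T } is closed, monotone and stably quasidense. -/
noncomputable section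

open Filter Topology

variable {E : Type*} [NormedAddCommGroup E] [NormedSpace ℝ E]

/-- `A ⊆ E × E*` is a monotone set. -/
def MonotoneSet (A : Set (E × (E →L[ℝ] ℝ))) : Prop :=
  A.Nonempty ∧ ∀ p ∈ A, ∀ q ∈ A, 0 ≤ (p.2 - q.2) (p.1 - q.1)

/-- `A ⊆ E × E*` is maximally monotone. -/
def MaxMonotone (A : Set (E × (E →L[ℝ] ℝ))) : Prop :=
  MonotoneSet A ∧ ∀ A' : Set (E × (E →L[ℝ] ℝ)), MonotoneSet A' → A ⊆ A' → A' = A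

/-- `r_L((s,s*) - (x,x*)) = (1/2)‖s - x‖² + (1/2)‖s* - x*‖² + ⟨s - x, s* - x*⟩`. -/
def rQ (q p : E × (E →L[ℝ] ℝ)) : ℝ :=
  (1 / 2) * ‖q.1 - p.1‖ ^ 2 + (1 / 2) * ‖q.2 - p.2‖ ^ 2 + (q.2 - p.2) (q.1 - p.1)

/-- `A ⊆ E × E*` is quasidense. -/
def Quasidense (A : Set (E × (E →L[ℝ] ℝ))) : Prop :=
  ∀ p : E × (E →L[ℝ] ℝ), (⨅ q ∈ A, ((rQ q p : ℝ) : EReal)) ≤ 0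

/-- `A ⊆ E × E*` is stably quasidense (with the norm
`‖(x, x*)‖ = (‖x‖² + ‖x*‖²)^{1/2}` on `E × E*`). -/
def StablyQuasidense (A : Set (E × (E →L[ℝ] ℝ))) : Prop :=
  ∀ p : E × (E →L[ℝ] ℝ), ∃ K : ℝ, 0 ≤ K ∧
    (⨅ q ∈ {q ∈ A | Real.sqrt (‖q.1 - p.1‖ ^ 2 + ‖q.2 - p.2‖ ^ 2) ≤ K},
      ((rQ q p : ℝ) : EReal)) ≤ 0

open scoped Pointwise

/-- The Fitzpatrick function of a monotone set `A ⊆ E × E*`: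
`φ_A(x, x*) = sup_{(s,s*) ∈ A} [⟨s, x*⟩ + ⟨x, s*⟩ - ⟨s, s*⟩]`. -/
def fitz (A : Set (E × (E →L[ℝ] ℝ))) (p : E × (E →L[ℝ] ℝ)) : EReal :=
  ⨆ q ∈ A, ((p.2 q.1 + q.2 p.1 - q.2 q.1 : ℝ) : EReal)

/-- `π₁ dom φ_A = {x : ∃ x*, φ_A(x, x*) < ∞}`. -/
def proj1domFitz (A : Set (E × (E →L[ℝ] ℝ))) : Set E :=
  {x : E | ∃ x' : E →L[ℝ] ℝ, fitz A (x, x') ≠ ⊤}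

/-- The sum `S + T` of two subsets of `E × E*`. -/
def sumSet (S T : Set (E × (E →L[ℝ] ℝ))) : Set (E × (E →L[ℝ] ℝ)) :=
  {p | ∃ s' t' : E →L[ℝ] ℝ, (p.1, s') ∈ S ∧ (p.1, t') ∈ T ∧ p.2 = s' + t'}

/-- A continuous linear functional almost attains the Fenchel conjugate of `½‖·‖²`. -/
lemma exists_half_norm_sq_add_le {F : Type*} [NormedAddCommGroup F] [NormedSpace ℝ F]
    (f : F →L[ℝ] ℝ) {ε : ℝ} (hε : 0 < ε) :
    ∃ v : F, 1 / 2 * ‖v‖ ^ 2 + f v ≤ -(1 / 2) * ‖f‖ ^ 2 + ε := by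
  rcases (norm_nonneg f).eq_or_lt' with h0 | hpos
  · exact ⟨0, by simp [h0, hε.le]⟩
  obtain ⟨u, hu1, hu⟩ := f.exists_lt_apply_of_lt_opNorm
    (show ‖f‖ - ε / ‖f‖ < ‖f‖ by have := div_pos hε hpos; linarith)
  have key : ∀ v : F, ‖v‖ < 1 → ‖f‖ - ε / ‖f‖ < f v →
      ∃ v : F, 1 / 2 * ‖v‖ ^ 2 + f v ≤ -(1 / 2) * ‖f‖ ^ 2 + ε := by
    intro v hv1 hv
    refine ⟨-(‖f‖ • v), ?_⟩
    have h1 : ‖f‖ * f v ≥ ‖f‖ ^ 2 - ε := by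
      have := mul_le_mul_of_nonneg_left hv.le hpos.le
      have h2 : ‖f‖ * (‖f‖ - ε / ‖f‖) = ‖f‖ ^ 2 - ε := by field_simp
      linarith
    have h2 : ‖-(‖f‖ • v)‖ ≤ ‖f‖ := by
      rw [norm_neg, norm_smul, norm_norm]
      nlinarith [norm_nonneg v]
    have h3 : ‖-(‖f‖ • v)‖ ^ 2 ≤ ‖f‖ ^ 2 := pow_le_pow_left₀ (norm_nonneg _) h2 2
    simp only [map_neg, map_smul, smul_eq_mul]
    linarith
  rcases abs_cases (f u) with ⟨h, -⟩ | ⟨h, -⟩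
  · exact key u hu1 (by rwa [Real.norm_eq_abs, h] at hu)
  · exact key (-u) (by rwa [norm_neg]) (by rwa [Real.norm_eq_abs, h, ← map_neg] at hu)

/-- Sandwich theorem: an affine function separates a convex set in `Z × ℝ` from the hypograph of
the continuous concave function `-G`. -/
lemma exists_affine_sandwich {Z : Type*} [NormedAddCommGroup Z] [NormedSpace ℝ Z]
    {C : Set (Z × ℝ)} (hC : Convex ℝ C) (hne : C.Nonempty) {G : Z → ℝ}
    (hG : ConvexOn ℝ Set.univ G) (hGc : Continuous G) (h : ∀ p ∈ C, 0 ≤ p.2 + G p.1) :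
    ∃ (l : Z →L[ℝ] ℝ) (k : ℝ), (∀ p ∈ C, l p.1 + k ≤ p.2) ∧ ∀ z, -G z ≤ l z + k := by
  have hU : IsOpen {p : Z × ℝ | p.2 < -G p.1} :=
    isOpen_lt continuous_snd (hGc.comp continuous_fst).neg
  have hUc : Convex ℝ {p : Z × ℝ | p.2 < -G p.1} := by
    have := hG.neg.convex_strict_hypograph
    simpa using this
  obtain ⟨f, u, hfU, hfC⟩ := geometric_hahn_banach_open hUc hU hC (by
    rw [Set.disjoint_left]
    intro p hp hpC
    have := h p hpC
    simp only [Set.mem_ofPred_eq] at hp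
    linarith)
  set m := f (0, 1) with hm
  have hf : ∀ z t, f (z, t) = f (z, 0) + t * m := by
    intro z t
    have : ((z, t) : Z × ℝ) = (z, 0) + t • (0, 1) := by simp
    rw [this, map_add, map_smul, smul_eq_mul]
  have hmpos : 0 < m := by
    obtain ⟨p, hp⟩ := hne
    have h1 := hfC p hp
    have h2 := hfU (p.1, p.2 - (p.2 + G p.1) - 1) (by simp)
    have h3 := hf p.1 p.2
    rw [hf] at h2
    rw [Prod.mk.eta] at h3
    rw [h3] at h1
    nlinarith [h p hp]
  refine ⟨-(m⁻¹ • f.comp (ContinuousLinearMap.inl ℝ Z ℝ)), m⁻¹ * u, ?_, ?_⟩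
  · intro p hp
    have h1 := hfC p hp
    have h3 := hf p.1 p.2
    rw [Prod.mk.eta] at h3
    rw [h3] at h1
    simp only [neg_apply, smul_apply,
      ContinuousLinearMap.comp_apply, ContinuousLinearMap.inl_apply, smul_eq_mul]
    have : m⁻¹ * (u - f (p.1, 0)) ≤ m⁻¹ * (p.2 * m) :=
      mul_le_mul_of_nonneg_left (by linarith) (by positivity)
    have h4 : m⁻¹ * (p.2 * m) = p.2 := by field_simp
    linarith
  · intro z
    simp only [neg_apply, smul_apply,
      ContinuousLinearMap.comp_apply, ContinuousLinearMap.inl_apply, smul_eq_mul]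
    by_contra! hlt
    have h1 := hfU (z, -(m⁻¹ * f (z, 0)) + m⁻¹ * u) hlt
    rw [hf] at h1
    have : (-(m⁻¹ * f (z, 0)) + m⁻¹ * u) * m = u - f (z, 0) := by field_simp; ring
    linarith

/-- Dyadic convex combinations stay in a convex set. -/
lemma Convex.sum_dyadic_add_mem {Z : Type*} [AddCommGroup Z] [Module ℝ Z]
    {K : Set Z} (hK : Convex ℝ K) {z : Z} (hz : z ∈ K) (n : ℕ) (a : ℕ → Z) (ha : ∀ k, a k ∈ K) :
    ∑ k ∈ Finset.range n, (1 / 2 : ℝ) ^ (k + 1) • a k + (1 / 2 : ℝ) ^ n • z ∈ K := by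
  induction n generalizing a with
  | zero => simpa using hz
  | succ n ih =>
    have h1 := hK (ha 0) (ih (fun k => a (k + 1)) fun k => ha _)
      (show (0 : ℝ) ≤ 1 / 2 by norm_num) (show (0 : ℝ) ≤ 1 / 2 by norm_num) (by norm_num)
    convert h1 using 1
    rw [Finset.sum_range_succ', smul_add, Finset.smul_sum]
    simp only [smul_smul, pow_succ']
    simp only [pow_zero, mul_one]
    abel

/-- If the image of a bounded closed convex set is dense in a ball, it contains the ball of half
the radius. -/
lemma exists_preimage_of_dense_image {Z W : Type*} [NormedAddCommGroup Z] [NormedSpace ℝ Z]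
    [CompleteSpace Z] [NormedAddCommGroup W] [NormedSpace ℝ W] (D : Z →L[ℝ] W)
    (V : Submodule ℝ W) {K : Set Z} (hKc : IsClosed K) (hK : Convex ℝ K) {R ρ : ℝ} (hρ : 0 < ρ)
    (hR : ∀ z ∈ K, ‖z‖ ≤ R) (hV : ∀ z ∈ K, D z ∈ V) {z₀ : Z} (hz₀ : z₀ ∈ K) (hD₀ : D z₀ = 0)
    (happ : ∀ w ∈ V, ‖w‖ ≤ ρ → ∀ ε > 0, ∃ z ∈ K, ‖w - D z‖ < ε)
    {w : W} (hw : w ∈ V) (hwn : ‖w‖ ≤ ρ / 2) : ∃ z ∈ K, D z = w := by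
  choose! g hgK hg using fun (w : W) (hw : w ∈ V ∧ ‖w‖ ≤ ρ) =>
    happ w hw.1 hw.2 (ρ / 2) (by linarith)
  let e : ℕ → W := fun n => Nat.rec ((2 : ℝ) • w) (fun _ x => (2 : ℝ) • (x - D (g x))) n
  have he0 : e 0 = (2 : ℝ) • w := rfl
  have hes : ∀ n, e (n + 1) = (2 : ℝ) • (e n - D (g (e n))) := fun n => rfl
  have he : ∀ n, e n ∈ V ∧ ‖e n‖ ≤ ρ := by
    intro n
    induction n with
    | zero =>
      refine ⟨V.smul_mem _ hw, ?_⟩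
      rw [he0, norm_smul]; norm_num; linarith
    | succ n ih =>
      rw [hes]
      refine ⟨V.smul_mem _ (V.sub_mem ih.1 (hV _ (hgK _ ih))), ?_⟩
      rw [norm_smul]; norm_num; linarith [hg _ ih]
  let y : ℕ → Z := fun n =>
    ∑ k ∈ Finset.range n, (1 / 2 : ℝ) ^ (k + 1) • g (e k) + (1 / 2 : ℝ) ^ n • z₀
  have hyK : ∀ n, y n ∈ K := fun n => hK.sum_dyadic_add_mem hz₀ n _ fun k => hgK _ (he k)
  have hys : ∀ n, y (n + 1) = y n + (1 / 2 : ℝ) ^ (n + 1) • (g (e n) - z₀) := by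
    intro n
    simp only [y, Finset.sum_range_succ, smul_sub]
    have : (1 / 2 : ℝ) ^ n • z₀ = (1 / 2 : ℝ) ^ (n + 1) • z₀ + (1 / 2 : ℝ) ^ (n + 1) • z₀ := by
      rw [← add_smul]; congr 1; ring
    rw [this]; abel
  have hDy : ∀ n, w = D (y n) + (1 / 2 : ℝ) ^ (n + 1) • e n := by
    intro n
    induction n with
    | zero => simp [y, he0, hD₀, smul_smul]
    | succ n ih =>
      rw [hys, hes, map_add, map_smul, map_sub, hD₀, sub_zero, smul_smul]
      have : (1 / 2 : ℝ) ^ (n + 1 + 1) * 2 = (1 / 2 : ℝ) ^ (n + 1) := by ring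
      rw [this, smul_sub, add_assoc, add_sub_cancel, ← ih]
  have hdist : ∀ n, dist (y n) (y (n + 1)) ≤ (2 * R) / 2 / 2 ^ n := by
    intro n
    rw [hys, dist_self_add_right, norm_smul]
    have h1 : ‖g (e n) - z₀‖ ≤ 2 * R :=
      (norm_sub_le _ _).trans (by linarith [hR _ (hgK _ (he n)), hR _ hz₀])
    have h2 : ‖(1 / 2 : ℝ) ^ (n + 1)‖ = 1 / 2 / 2 ^ n := by
      rw [Real.norm_of_nonneg (by positivity), one_div_pow, pow_succ]; field_simp
    rw [h2]
    calc 1 / 2 / 2 ^ n * ‖g (e n) - z₀‖ ≤ 1 / 2 / 2 ^ n * (2 * R) := by gcongr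
      _ = _ := by ring
  obtain ⟨z, hz⟩ := cauchySeq_tendsto_of_complete (cauchySeq_of_le_geometric_two hdist)
  refine ⟨z, hKc.mem_of_tendsto hz (Eventually.of_forall hyK), ?_⟩
  have h1 : Tendsto (fun n => D (y n)) atTop (𝓝 (D z)) := (D.continuous.tendsto z).comp hz
  have h2 : Tendsto (fun n => w - D (y n)) atTop (𝓝 0) := by
    refine squeeze_zero_norm (a := fun n => (1 / 2 : ℝ) ^ n * ρ) (fun n => ?_) ?_
    · have : w - D (y n) = (1 / 2 : ℝ) ^ (n + 1) • e n := by
        conv_lhs => rw [hDy n]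
        simp
      rw [this, norm_smul, Real.norm_of_nonneg (by positivity)]
      exact mul_le_mul (pow_le_pow_of_le_one (by norm_num) (by norm_num) n.le_succ) (he n).2
        (norm_nonneg _) (by positivity)
    · have := (tendsto_pow_atTop_nhds_zero_of_lt_one (r := (1 / 2 : ℝ)) (by norm_num)
        (by norm_num)).mul_const ρ
      simpa using this
  have h3 := tendsto_nhds_unique h2 (tendsto_const_nhds.sub h1)
  exact (sub_eq_zero.mp h3.symm).symm

/-- An increasing sequence of bounded closed convex sets whose images under a continuous linear
map absorb a Banach space `V` contains a member whose image is a neighbourhood of zero in `V`. -/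
lemma exists_ball_subset_image {Z W : Type*} [NormedAddCommGroup Z] [NormedSpace ℝ Z]
    [CompleteSpace Z] [NormedAddCommGroup W] [NormedSpace ℝ W] [CompleteSpace W] (D : Z →L[ℝ] W)
    (V : Submodule ℝ W) (hVc : IsClosed (V : Set W)) {K : ℕ → Set Z} (hmono : Monotone K)
    (hKc : ∀ n, IsClosed (K n)) (hK : ∀ n, Convex ℝ (K n))
    (hR : ∀ n, ∃ R : ℝ, ∀ z ∈ K n, ‖z‖ ≤ R) (hV : ∀ n, ∀ z ∈ K n, D z ∈ V)
    (habs : ∀ w ∈ V, ∃ n, ∃ l > (0 : ℝ), ∃ z ∈ K n, w = l • D z) :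
    ∃ n, ∃ ρ > 0, ∀ w ∈ V, ‖w‖ ≤ ρ → ∃ z ∈ K n, D z = w := by
  have : CompleteSpace V := hVc.completeSpace_coe
  let P : ℕ → Set V := fun m => {w | ∃ l ∈ Set.Icc (0 : ℝ) m, ∃ z ∈ K m, (w : W) = l • D z}
  obtain ⟨m, w₀, hw₀⟩ := nonempty_interior_of_iUnion_of_closed (f := fun m => closure (P m))
    (fun _ => isClosed_closure) (by
      rw [Set.eq_univ_iff_forall]
      rintro ⟨w, hw⟩
      obtain ⟨n, l, hl, z, hz, e⟩ := habs w hw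
      obtain ⟨N, hN⟩ := exists_nat_ge l
      refine Set.mem_iUnion.2 ⟨max n N, subset_closure ⟨l, ⟨hl.le, ?_⟩, z, ?_, e⟩⟩
      · exact hN.trans (by exact_mod_cast le_max_right n N)
      · exact hmono (le_max_left n N) hz)
  obtain ⟨r, hr, hball⟩ := Metric.mem_nhds_iff.1 (mem_interior_iff_mem_nhds.1 hw₀)
  obtain ⟨n₁, l₁, hl₁, z₁, hz₁, e₁⟩ := habs (-(w₀ : W)) (V.neg_mem w₀.2)
  obtain ⟨n₂, l₂, hl₂, z₂, hz₂, e₂⟩ := habs 0 V.zero_mem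
  have hDz₂ : D z₂ = 0 := by
    have := e₂.symm
    rwa [smul_eq_zero_iff_right hl₂.ne'] at this
  set N := max m (max n₁ n₂) with hN
  have hmN := hmono (show m ≤ N from le_max_left _ _)
  have h1N : z₁ ∈ K N := hmono ((le_max_left n₁ n₂).trans (le_max_right _ _)) hz₁
  have h2N : z₂ ∈ K N := hmono ((le_max_right n₁ n₂).trans (le_max_right _ _)) hz₂
  set L : ℝ := m + l₁ with hL
  have hLpos : 0 < L := by positivity
  obtain ⟨R, hRN⟩ := hR N
  refine ⟨N, r / (2 * L) / 2, by positivity, fun w hw hwn =>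
    exists_preimage_of_dense_image D V (hKc N) (hK N) (show 0 < r / (2 * L) by positivity) hRN
      (hV N)
      h2N hDz₂ ?_ hw hwn⟩
  intro v hv hvn ε hε
  have hmem : w₀ + ⟨L • v, V.smul_mem _ hv⟩ ∈ closure (P m) := by
    apply hball
    rw [Metric.mem_ball, dist_self_add_left]
    change ‖L • v‖ < r
    rw [norm_smul, Real.norm_of_nonneg hLpos.le]
    calc L * ‖v‖ ≤ L * (r / (2 * L)) := by gcongr
      _ = r / 2 := by field_simp
      _ < r := by linarith
  obtain ⟨p, ⟨l, ⟨hl0, hlm⟩, z, hz, ep⟩, hp⟩ :=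
    Metric.mem_closure_iff.1 hmem (L * ε) (by positivity)
  have hcomb : (l / L) • z + (l₁ / L) • z₁ + ((m - l) / L) • z₂ ∈ K N := by
    have := (hK N).sum_mem (t := Finset.univ) (w := ![l / L, l₁ / L, (m - l) / L])
      (z := ![z, z₁, z₂]) ?_ ?_ ?_
    · simpa [Fin.sum_univ_three] using this
    · intro i _
      fin_cases i
      · simpa using by positivity
      · simpa using by positivity
      · simpa using div_nonneg (by linarith) hLpos.le
    · simp only [Fin.sum_univ_three, Matrix.cons_val]
      field_simp
      rw [hL]; ring
    · intro i _
      fin_cases i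
      · exact hmN hz
      · exact h1N
      · exact h2N
  refine ⟨_, hcomb, ?_⟩
  have h3 : v - D ((l / L) • z + (l₁ / L) • z₁ + ((m - l) / L) • z₂)
      = L⁻¹ • ((w₀ : W) + L • v - p) := by
    simp only [map_add, map_smul, hDz₂, smul_zero, add_zero]
    have e4 : (l / L) • D z = L⁻¹ • (p : W) := by rw [ep, smul_smul]; congr 1; ring
    have e5 : (l₁ / L) • D z₁ = -(L⁻¹ • (w₀ : W)) := by
      rw [← smul_neg, e₁, smul_smul]; congr 1; ring
    rw [e4, e5, smul_sub, smul_add, smul_smul, inv_mul_cancel₀ hLpos.ne', one_smul]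
    abel
  rw [h3, norm_smul, norm_inv, Real.norm_of_nonneg hLpos.le]
  have h4 : ‖(w₀ : W) + L • v - p‖ < L * ε := by
    rw [dist_eq_norm] at hp
    exact hp
  calc L⁻¹ * ‖(w₀ : W) + L • v - p‖ < L⁻¹ * (L * ε) := by gcongr
    _ = ε := by field_simp

/-- Young's inequality for the duality pairing. -/
lemma half_norm_sq_add_apply_nonneg {F : Type*} [NormedAddCommGroup F] [NormedSpace ℝ F]
    (f : F →L[ℝ] ℝ) (v : F) : 0 ≤ 1 / 2 * ‖v‖ ^ 2 + f v + 1 / 2 * ‖f‖ ^ 2 := by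
  have h1 := f.le_opNorm v
  rw [Real.norm_eq_abs] at h1
  nlinarith [neg_abs_le (f v), sq_nonneg (‖v‖ - ‖f‖)]

lemma apply_le_of_norm_le {F : Type*} [NormedAddCommGroup F] [NormedSpace ℝ F]
    {f : F →L[ℝ] ℝ} {v : F} {a b : ℝ} (hf : ‖f‖ ≤ a) (hv : ‖v‖ ≤ b) : f v ≤ a * b :=
  (Real.le_norm_self _).trans ((f.le_opNorm v).trans
    (mul_le_mul hf hv (norm_nonneg _) ((norm_nonneg _).trans hf)))

lemma rQ_nonneg (q p : E × (E →L[ℝ] ℝ)) : 0 ≤ rQ q p := by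
  have := half_norm_sq_add_apply_nonneg (q.2 - p.2) (q.1 - p.1)
  unfold rQ
  linarith

lemma Quasidense.exists_rQ_lt {A : Set (E × (E →L[ℝ] ℝ))} (hA : Quasidense A)
    (p : E × (E →L[ℝ] ℝ)) {ε : ℝ} (hε : 0 < ε) : ∃ q ∈ A, rQ q p < ε := by
  have h : (⨅ q ∈ A, ((rQ q p : ℝ) : EReal)) < (ε : EReal) :=
    (hA p).trans_lt (by exact_mod_cast hε)
  simp only [iInf_lt_iff, exists_prop] at h
  obtain ⟨q, hq, hlt⟩ := h
  exact ⟨q, hq, by exact_mod_cast hlt⟩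

/-- The inequality `φ_A(p) ≤ i` for a real number `i`. -/
def FitzLE (A : Set (E × (E →L[ℝ] ℝ))) (p : E × (E →L[ℝ] ℝ)) (i : ℝ) : Prop :=
  ∀ s ∈ A, p.2 s.1 + s.2 p.1 - s.2 s.1 ≤ i

lemma fitz_ne_top_iff {A : Set (E × (E →L[ℝ] ℝ))} {p : E × (E →L[ℝ] ℝ)} :
    fitz A p ≠ ⊤ ↔ ∃ i, FitzLE A p i := by
  have key : ∀ i : ℝ, fitz A p ≤ (i : EReal) ↔ FitzLE A p i := fun i => by
    simp only [fitz, iSup_le_iff, FitzLE, EReal.coe_le_coe_iff]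
  constructor
  · intro h
    obtain ⟨i, hi, -⟩ := EReal.lt_iff_exists_real_btwn.1 (lt_top_iff_ne_top.2 h)
    exact ⟨i, (key i).1 hi.le⟩
  · rintro ⟨i, hi⟩
    exact (((key i).2 hi).trans_lt (EReal.coe_lt_top i)).ne

lemma mem_proj1domFitz_iff {A : Set (E × (E →L[ℝ] ℝ))} {x : E} :
    x ∈ proj1domFitz A ↔ ∃ ξ i, FitzLE A (x, ξ) i := by
  change (∃ ξ, fitz A (x, ξ) ≠ ⊤) ↔ _
  simp only [fitz_ne_top_iff]

lemma FitzLE.mono {A : Set (E × (E →L[ℝ] ℝ))} {p : E × (E →L[ℝ] ℝ)} {i j : ℝ}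
    (h : FitzLE A p i) (hij : i ≤ j) : FitzLE A p j := fun s hs => (h s hs).trans hij

lemma MonotoneSet.fitzLE {A : Set (E × (E →L[ℝ] ℝ))} (hA : MonotoneSet A)
    {p : E × (E →L[ℝ] ℝ)} (hp : p ∈ A) : FitzLE A p (p.2 p.1) := by
  intro s hs
  have := hA.2 p hp s hs
  simp only [map_sub, sub_apply] at this
  linarith

lemma FitzLE.combo {A : Set (E × (E →L[ℝ] ℝ))} {p q : E × (E →L[ℝ] ℝ)} {i j a b : ℝ}
    (hp : FitzLE A p i) (hq : FitzLE A q j) (ha : 0 ≤ a) (hb : 0 ≤ b) (hab : a + b = 1) :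
    FitzLE A (a • p + b • q) (a * i + b * j) := by
  intro s hs
  have h1 := mul_le_mul_of_nonneg_left (hp s hs) ha
  have h2 := mul_le_mul_of_nonneg_left (hq s hs) hb
  simp only [Prod.fst_add, Prod.snd_add, Prod.smul_fst, Prod.smul_snd, add_apply, smul_apply,
    map_add, map_smul, smul_eq_mul]
  have h3 : s.2 s.1 = a * s.2 s.1 + b * s.2 s.1 := by rw [← add_mul, hab, one_mul]
  linarith

lemma isClosed_setOf_fitzLE {Z : Type*} [TopologicalSpace Z] (A : Set (E × (E →L[ℝ] ℝ))) (i : ℝ)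
    {f : Z → E × (E →L[ℝ] ℝ)} (hf : Continuous f) : IsClosed {z | FitzLE A (f z) i} := by
  simp only [FitzLE, Set.ofPred_forall]
  refine isClosed_biInter fun s _ => isClosed_le ?_ continuous_const
  have h1 : Continuous fun z => (f z).2 s.1 := by fun_prop
  have h2 : Continuous fun z => s.2 (f z).1 := by fun_prop
  exact (h1.add h2).sub continuous_const

lemma Quasidense.le_of_fitzLE {A : Set (E × (E →L[ℝ] ℝ))} (hA : Quasidense A)
    {p : E × (E →L[ℝ] ℝ)} {i : ℝ} (h : FitzLE A p i) : p.2 p.1 ≤ i := by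
  refine le_of_forall_pos_le_add fun ε hε => ?_
  obtain ⟨q, hq, hlt⟩ := hA.exists_rQ_lt p hε
  have h1 := h q hq
  simp only [rQ, map_sub, sub_apply] at hlt
  nlinarith [sq_nonneg ‖q.1 - p.1‖, sq_nonneg ‖q.2 - p.2‖]

lemma Quasidense.mem_of_fitzLE {A : Set (E × (E →L[ℝ] ℝ))} (hA : Quasidense A)
    (hc : IsClosed A) {p : E × (E →L[ℝ] ℝ)} (h : FitzLE A p (p.2 p.1)) : p ∈ A := by
  rw [← hc.closure_eq, Metric.mem_closure_iff]
  intro ε hε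
  obtain ⟨q, hq, hlt⟩ := hA.exists_rQ_lt p (show 0 < ε ^ 2 / 2 by positivity)
  refine ⟨q, hq, ?_⟩
  have h1 := h q hq
  simp only [rQ, map_sub, sub_apply] at hlt
  have h2 : ‖q.1 - p.1‖ < ε :=
    lt_of_pow_lt_pow_left₀ 2 hε.le (by nlinarith [sq_nonneg ‖q.2 - p.2‖])
  have h3 : ‖q.2 - p.2‖ < ε :=
    lt_of_pow_lt_pow_left₀ 2 hε.le (by nlinarith [sq_nonneg ‖q.1 - p.1‖])
  rw [dist_comm, Prod.dist_eq, dist_eq_norm, dist_eq_norm]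
  exact max_lt h2 h3

/-- A quasidense set is of negative infimum type. -/
lemma Quasidense.negativeInfimum {A : Set (E × (E →L[ℝ] ℝ))} (hA : Quasidense A)
    (a : E →L[ℝ] ℝ) (b : (E →L[ℝ] ℝ) →L[ℝ] ℝ) {ε : ℝ} (hε : 0 < ε) :
    ∃ s ∈ A, s.2 s.1 ≤ a s.1 + b s.2 - b a + ε := by
  obtain ⟨v, hv⟩ := exists_half_norm_sq_add_le b (half_pos hε)
  obtain ⟨q, hq, hlt⟩ := hA.exists_rQ_lt (0, a - v) (half_pos hε)
  refine ⟨q, hq, ?_⟩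
  have h1 := half_norm_sq_add_apply_nonneg v q.1
  have h2 := half_norm_sq_add_apply_nonneg b (q.2 - (a - v))
  simp only [rQ, map_sub, sub_apply, sub_zero] at hlt h2
  linarith

lemma Quasidense.neg_apply_sub_le {A : Set (E × (E →L[ℝ] ℝ))} (hA : Quasidense A)
    {p q : E × (E →L[ℝ] ℝ)} {i j : ℝ} (hp : FitzLE A p i) (hq : FitzLE A q j) :
    -(p.2 - q.2) (p.1 - q.1) ≤ 2 * (i - p.2 p.1) + 2 * (j - q.2 q.1) := by
  have h := hA.le_of_fitzLE (hp.combo hq (show (0 : ℝ) ≤ 1 / 2 by norm_num)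
    (show (0 : ℝ) ≤ 1 / 2 by norm_num) (by norm_num))
  simp only [Prod.fst_add, Prod.snd_add, Prod.smul_fst, Prod.smul_snd, add_apply, smul_apply,
    map_add, map_smul, smul_eq_mul] at h
  simp only [map_sub, sub_apply]
  linarith

/-- The form in which the constraint qualification is used: differences of points where the
Fitzpatrick functions are finite lie in `V`, and they fill a ball of `V` with uniform bounds. -/
structure Qualified (S T : Set (E × (E →L[ℝ] ℝ))) (V : Submodule ℝ E) (ρ R : ℝ) : Prop where
  pos : 0 < ρ
  sub_mem : ∀ {x ξ i u η j}, FitzLE S (x, ξ) i → FitzLE T (u, η) j → x - u ∈ V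
  exists_sub_eq : ∀ w ∈ V, ‖w‖ ≤ ρ → ∃ x ξ u η, FitzLE S (x, ξ) R ∧ FitzLE T (u, η) R ∧
    ‖x‖ ≤ R ∧ ‖ξ‖ ≤ R ∧ ‖u‖ ≤ R ∧ ‖η‖ ≤ R ∧ x - u = w

lemma exists_qualified [CompleteSpace E] {S T : Set (E × (E →L[ℝ] ℝ))}
    {V : Submodule ℝ E} (hVclosed : IsClosed (V : Set E))
    (hV : (⋃ l ∈ Set.Ioi (0 : ℝ), l • (proj1domFitz S - proj1domFitz T)) = (V : Set E)) :
    ∃ ρ R, Qualified S T V ρ R := by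
  have hmem : ∀ w, w ∈ V ↔ ∃ l > (0 : ℝ), ∃ x ξ i u η j,
      FitzLE S (x, ξ) i ∧ FitzLE T (u, η) j ∧ w = l • (x - u) := by
    intro w
    rw [← SetLike.mem_coe, ← hV]
    simp only [Set.mem_iUnion, Set.mem_Ioi, exists_prop, Set.mem_smul_set, Set.mem_sub,
      mem_proj1domFitz_iff]
    constructor
    · rintro ⟨l, hl, -, ⟨x, ⟨ξ, i, h1⟩, u, ⟨η, j, h2⟩, rfl⟩, rfl⟩
      exact ⟨l, hl, x, ξ, i, u, η, j, h1, h2, rfl⟩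
    · rintro ⟨l, hl, x, ξ, i, u, η, j, h1, h2, rfl⟩
      exact ⟨l, hl, _, ⟨x, ⟨ξ, i, h1⟩, u, ⟨η, j, h2⟩, rfl⟩, rfl⟩
  have hsub : ∀ {x ξ i u η j}, FitzLE S (x, ξ) i → FitzLE T (u, η) j → x - u ∈ V :=
    fun {x ξ i u η j} h1 h2 =>
      (hmem _).2 ⟨1, one_pos, x, ξ, i, u, η, j, h1, h2, (one_smul _ _).symm⟩
  let K : ℕ → Set (E × (E →L[ℝ] ℝ) × E × (E →L[ℝ] ℝ)) := fun n =>
    {z | FitzLE S (z.1, z.2.1) n ∧ FitzLE T (z.2.2.1, z.2.2.2) n ∧ ‖z‖ ≤ n}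
  let D : (E × (E →L[ℝ] ℝ) × E × (E →L[ℝ] ℝ)) →L[ℝ] E :=
    ContinuousLinearMap.fst ℝ _ _ - (ContinuousLinearMap.fst ℝ _ _).comp
      ((ContinuousLinearMap.snd ℝ _ _).comp (ContinuousLinearMap.snd ℝ _ _))
  have hmono : Monotone K := by
    rintro m n hmn z ⟨h1, h2, h3⟩
    have : (m : ℝ) ≤ n := by exact_mod_cast hmn
    exact ⟨h1.mono this, h2.mono this, h3.trans this⟩
  have hclosed : ∀ n, IsClosed (K n) := fun n =>
    (isClosed_setOf_fitzLE S n (by fun_prop)).inter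
      ((isClosed_setOf_fitzLE T n (by fun_prop)).inter
        (isClosed_le continuous_norm continuous_const))
  have hconv : ∀ n, Convex ℝ (K n) := by
    rintro n z ⟨h1, h2, h3⟩ z' ⟨h1', h2', h3'⟩ a b ha hb hab
    have e : (n : ℝ) = a * n + b * n := by rw [← add_mul, hab, one_mul]
    have h4 : ‖a • z + b • z'‖ ≤ a * n + b * n := by
      refine (norm_add_le _ _).trans ?_
      rw [norm_smul, norm_smul, Real.norm_of_nonneg ha, Real.norm_of_nonneg hb]
      gcongr
    exact ⟨(h1.combo h1' ha hb hab).mono e.ge, (h2.combo h2' ha hb hab).mono e.ge, h4.trans e.ge⟩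
  have habs : ∀ w ∈ V, ∃ n, ∃ l > (0 : ℝ), ∃ z ∈ K n, w = l • D z := by
    intro w hw
    obtain ⟨l, hl, x, ξ, i, u, η, j, h1, h2, rfl⟩ := (hmem w).1 hw
    obtain ⟨n, hn⟩ := exists_nat_ge (max i (max j ‖(x, ξ, u, η)‖))
    simp only [sup_le_iff] at hn
    exact ⟨n, l, hl, (x, ξ, u, η), ⟨h1.mono hn.1, h2.mono hn.2.1, hn.2.2⟩, rfl⟩
  obtain ⟨n, ρ, hρ, hball⟩ := exists_ball_subset_image D V hVclosed hmono hclosed hconv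
    (fun n => ⟨n, fun z hz => hz.2.2⟩) (fun n z hz => hsub hz.1 hz.2.1) habs
  refine ⟨ρ, n, hρ, hsub, fun w hw hwρ => ?_⟩
  obtain ⟨⟨x, ξ, u, η⟩, ⟨h1, h2, h3⟩, h4⟩ := hball w hw hwρ
  simp only [Prod.norm_mk, sup_le_iff] at h3
  exact ⟨x, ξ, u, η, h1, h2, h3.1, h3.2.1, h3.2.2.1, h3.2.2.2, h4⟩

/-- Exact penalization: a lower bound on the diagonal `x = u` extends to all `x`, `u` at the cost of
a multiple of `‖x - u‖`. -/
lemma Qualified.exists_penalty {S T : Set (E × (E →L[ℝ] ℝ))} {V : Submodule ℝ E} {ρ R : ℝ}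
    (h : Qualified S T V ρ R) {G : E × (E →L[ℝ] ℝ) → ℝ} (hG : ConvexOn ℝ Set.univ G)
    {M : ℝ} (hM : ∀ x ζ, ‖x‖ ≤ R → ‖ζ‖ ≤ 2 * R → G (x, ζ) ≤ M) {c : ℝ} (hc0 : 0 ≤ c)
    (hc : ∀ x ξ η i j, FitzLE S (x, ξ) i → FitzLE T (x, η) j → c ≤ i + j + G (x, ξ + η)) :
    ∃ n ≥ 0, ∀ x ξ u η i j, FitzLE S (x, ξ) i → FitzLE T (u, η) j →
      c ≤ i + j + G (x, ξ + η) + n * ‖x - u‖ := by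
  have hρ := h.pos
  refine ⟨|2 * R + M| / ρ, by positivity, fun x ξ u η i j hS hT => ?_⟩
  rcases (norm_nonneg (x - u)).eq_or_lt' with h0 | hpos
  · obtain rfl : x = u := sub_eq_zero.1 (norm_eq_zero.1 h0)
    rw [h0, mul_zero, add_zero]
    exact hc _ _ _ _ _ hS hT
  set e := ‖x - u‖ with he
  obtain ⟨x', ξ', u', η', hS', hT', hx', hξ', hu', hη', hd⟩ := h.exists_sub_eq
    (-(ρ / e) • (x - u)) (V.smul_mem _ (h.sub_mem hS hT)) (by
      rw [norm_smul, norm_neg, Real.norm_of_nonneg (by positivity), ← he]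
      field_simp; rfl)
  have hGM := hM x' (ξ' + η') hx' ((norm_add_le _ _).trans (by linarith))
  have hse : 0 < ρ + e := by positivity
  have ha : 0 ≤ ρ / (ρ + e) := by positivity
  have hb : 0 ≤ e / (ρ + e) := by positivity
  have hab : ρ / (ρ + e) + e / (ρ + e) = 1 := by field_simp
  have hS2 := hS.combo hS' ha hb hab
  have hT2 := hT.combo hT' ha hb hab
  have hdiag : (ρ / (ρ + e)) • u + (e / (ρ + e)) • u' = (ρ / (ρ + e)) • x + (e / (ρ + e)) • x' := by
    obtain rfl : x' = u' + -(ρ / e) • (x - u) := by rw [← hd]; abel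
    have : e / (ρ + e) * -(ρ / e) = -(ρ / (ρ + e)) := by field_simp
    rw [smul_add, smul_smul, this]
    module
  have h1 := hc _ _ _ _ _ hS2 (by
    simpa only [Prod.smul_mk, Prod.mk_add_mk, hdiag] using hT2)
  have h2 := hG.2 (Set.mem_univ (x, ξ + η)) (Set.mem_univ (x', ξ' + η')) ha hb hab
  have e1 : (ρ / (ρ + e)) • (x, ξ + η) + (e / (ρ + e)) • (x', ξ' + η') =
      ((ρ / (ρ + e)) • x + (e / (ρ + e)) • x',
        ((ρ / (ρ + e)) • ξ + (e / (ρ + e)) • ξ') + ((ρ / (ρ + e)) • η + (e / (ρ + e)) • η')) := by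
    simp only [Prod.smul_mk, Prod.mk_add_mk, smul_add]
    congr 1
    abel
  rw [e1] at h2
  simp only [smul_eq_mul, Prod.smul_mk] at h1 h2
  have h3 : c ≤ ρ / (ρ + e) * (i + j + G (x, ξ + η)) + e / (ρ + e) * (2 * R + M) := by
    nlinarith [mul_le_mul_of_nonneg_left hGM hb]
  have h4 : c * (ρ + e) ≤ ρ * (i + j + G (x, ξ + η)) + e * (2 * R + M) := by
    calc c * (ρ + e) ≤
        (ρ / (ρ + e) * (i + j + G (x, ξ + η)) + e / (ρ + e) * (2 * R + M)) * (ρ + e) := by gcongr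
      _ = _ := by field_simp
  have h5 : e * (2 * R + M) ≤ e * |2 * R + M| := by gcongr; exact le_abs_self _
  have h6 : c * ρ ≤ (i + j + G (x, ξ + η) + |2 * R + M| / ρ * e) * ρ := by
    have : |2 * R + M| / ρ * e * ρ = e * |2 * R + M| := by field_simp
    nlinarith [mul_nonneg hc0 hpos.le]
  exact le_of_mul_le_mul_right h6 hρ

/-- Fenchel duality for the partial sum of two Fitzpatrick functions and a convex function. -/
lemma Qualified.exists_dual {S T : Set (E × (E →L[ℝ] ℝ))} {V : Submodule ℝ E} {ρ R : ℝ}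
    (h : Qualified S T V ρ R) (hS : MonotoneSet S) (hT : MonotoneSet T)
    {G : E × (E →L[ℝ] ℝ) → ℝ} (hG : ConvexOn ℝ Set.univ G) (hGc : Continuous G)
    {M : ℝ} (hM : ∀ x ζ, ‖x‖ ≤ R → ‖ζ‖ ≤ 2 * R → G (x, ζ) ≤ M) {c : ℝ} (hc0 : 0 ≤ c)
    (hc : ∀ x ξ η i j, FitzLE S (x, ξ) i → FitzLE T (x, η) j → c ≤ i + j + G (x, ξ + η)) :
    ∃ (a b : E →L[ℝ] ℝ) (y : (E →L[ℝ] ℝ) →L[ℝ] ℝ) (k : ℝ),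
      (∀ s ∈ S, ∀ t ∈ T, a s.1 + y s.2 + (b t.1 + y t.2) + k + c ≤ s.2 s.1 + t.2 t.1) ∧
      ∀ x ζ, 0 ≤ G (x, ζ) + (a + b) x + y ζ + k := by
  obtain ⟨n, hn, hpen⟩ := h.exists_penalty hG hM hc0 hc
  let Z := E × (E →L[ℝ] ℝ) × E × (E →L[ℝ] ℝ)
  let C : Set (Z × ℝ) := {p | ∃ i j, FitzLE S (p.1.1, p.1.2.1) i ∧
    FitzLE T (p.1.2.2.1, p.1.2.2.2) j ∧ i + j - c ≤ p.2}
  let P : Z →L[ℝ] E × (E →L[ℝ] ℝ) :=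
    ((ContinuousLinearMap.fst ℝ _ _)).prod
      ((ContinuousLinearMap.fst ℝ _ _).comp (ContinuousLinearMap.snd ℝ _ _) +
        (ContinuousLinearMap.snd ℝ _ _).comp
          ((ContinuousLinearMap.snd ℝ _ _).comp (ContinuousLinearMap.snd ℝ _ _)))
  let D : Z →L[ℝ] E :=
    ContinuousLinearMap.fst ℝ _ _ - (ContinuousLinearMap.fst ℝ _ _).comp
      ((ContinuousLinearMap.snd ℝ _ _).comp (ContinuousLinearMap.snd ℝ _ _))
  have hP : ∀ z : Z, P z = (z.1, z.2.1 + z.2.2.2) := fun z => rfl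
  have hD : ∀ z : Z, D z = z.1 - z.2.2.1 := fun z => rfl
  have hCc : Convex ℝ C := by
    rintro p ⟨i, j, h1, h2, h3⟩ q ⟨i', j', h1', h2', h3'⟩ a b ha hb hab
    have h6 := h1.combo h1' ha hb hab
    have h7 := h2.combo h2' ha hb hab
    rw [Prod.smul_mk, Prod.smul_mk, Prod.mk_add_mk] at h6 h7
    refine ⟨a * i + b * i', a * j + b * j', h6, h7, ?_⟩
    have e : c = a * c + b * c := by rw [← add_mul, hab, one_mul]
    have h4 := mul_le_mul_of_nonneg_left h3 ha
    have h5 := mul_le_mul_of_nonneg_left h3' hb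
    simp only [Prod.snd_add, Prod.smul_snd, smul_eq_mul]
    linarith
  have hmemC : ∀ s ∈ S, ∀ t ∈ T, ((s.1, s.2, t.1, t.2), s.2 s.1 + t.2 t.1 - c) ∈ C :=
    fun s hs t ht => ⟨s.2 s.1, t.2 t.1, hS.fitzLE hs, hT.fitzLE ht, le_refl _⟩
  obtain ⟨s₀, hs₀⟩ := hS.1
  obtain ⟨t₀, ht₀⟩ := hT.1
  have hconv : ConvexOn ℝ Set.univ fun z : Z => G (P z) + n * ‖D z‖ := by
    have h1 : ConvexOn ℝ Set.univ fun z : Z => G (P z) := hG.comp_linearMap P.toLinearMap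
    have h2 : ConvexOn ℝ Set.univ fun z : Z => ‖D z‖ :=
      (convexOn_univ_norm (E := E)).comp_linearMap D.toLinearMap
    exact h1.add (h2.smul hn)
  obtain ⟨l, k, hl1, hl2⟩ := exists_affine_sandwich hCc ⟨_, hmemC _ hs₀ _ ht₀⟩ hconv
    ((hGc.comp P.continuous).add (continuous_const.mul D.continuous.norm)) (by
      rintro p ⟨i, j, h1, h2, h3⟩
      have := hpen _ _ _ _ _ _ h1 h2
      simp only [hP, hD]
      linarith)
  let a : E →L[ℝ] ℝ := l.comp (ContinuousLinearMap.inl ℝ _ _)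
  let y : (E →L[ℝ] ℝ) →L[ℝ] ℝ :=
    l.comp ((ContinuousLinearMap.inr ℝ _ _).comp (ContinuousLinearMap.inl ℝ _ _))
  let b : E →L[ℝ] ℝ := l.comp ((ContinuousLinearMap.inr ℝ _ _).comp
    ((ContinuousLinearMap.inr ℝ _ _).comp (ContinuousLinearMap.inl ℝ _ _)))
  let y' : (E →L[ℝ] ℝ) →L[ℝ] ℝ := l.comp ((ContinuousLinearMap.inr ℝ _ _).comp
    ((ContinuousLinearMap.inr ℝ _ _).comp (ContinuousLinearMap.inr ℝ _ _)))
  have hl : ∀ x ξ u η, l (x, ξ, u, η) = a x + (y ξ + (b u + y' η)) := by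
    intro x ξ u η
    have e : ((x, ξ, u, η) : Z) =
        (x, 0, 0, 0) + ((0, ξ, 0, 0) + ((0, 0, u, 0) + (0, 0, 0, η))) := by
      simp
    rw [e, map_add, map_add, map_add]
    rfl
  have hy' : ∀ η, y' η = y η := by
    intro η
    have key : ∀ r : ℝ, -G (0, 0) - k ≤ r * (y' η - y η) := by
      intro r
      have h1 := hl2 (0, -(r • η), 0, r • η)
      rw [hP, hD, hl] at h1
      simp only [map_zero, neg_add_cancel, sub_self, norm_zero, map_neg, map_smul,
        smul_eq_mul] at h1
      linarith
    by_contra hne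
    have hne' : y' η - y η ≠ 0 := sub_ne_zero.2 hne
    have := key ((-G (0, 0) - k - 1) / (y' η - y η))
    rw [div_mul_cancel₀ _ hne'] at this
    linarith
  refine ⟨a, b, y, k, fun s hs t ht => ?_, fun x ζ => ?_⟩
  · have h1 := hl1 _ (hmemC s hs t ht)
    rw [hl, hy'] at h1
    linarith
  · have h1 := hl2 (x, ζ, x, 0)
    rw [hP, hD, hl] at h1
    simp only [map_zero, add_zero, sub_self, norm_zero, mul_zero] at h1
    simp only [add_apply]
    linarith

/-- `p` is, up to `δ`, in the sum of `S` and `T`. -/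
def ApproxSum (S T : Set (E × (E →L[ℝ] ℝ))) (δ : ℝ) (p : E × (E →L[ℝ] ℝ)) : Prop :=
  ∃ ξ η i j, FitzLE S (p.1, ξ) i ∧ FitzLE T (p.1, η) j ∧ ξ + η = p.2 ∧
    (i - ξ p.1) + (j - η p.1) ≤ δ

lemma Qualified.exists_approxSum {S T : Set (E × (E →L[ℝ] ℝ))} {V : Submodule ℝ E} {ρ R : ℝ}
    (h : Qualified S T V ρ R) (hS : MonotoneSet S) (hT : MonotoneSet T) (hSqd : Quasidense S)
    (hTqd : Quasidense T) (p : E × (E →L[ℝ] ℝ)) {ε : ℝ} (hε : 0 < ε) :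
    ∃ q, ApproxSum S T ε q ∧ rQ q p ≤ ε := by
  let G : E × (E →L[ℝ] ℝ) → ℝ := fun q =>
    1 / 2 * ‖q.1 - p.1‖ ^ 2 + 1 / 2 * ‖q.2 - p.2‖ ^ 2 + (-p.2 q.1 - q.2 p.1 + p.2 p.1)
  have hrQ : ∀ q, rQ q p = G q + q.2 q.1 := by
    intro q
    simp only [rQ, G, map_sub, sub_apply]
    ring
  suffices ∃ x ξ η i j, FitzLE S (x, ξ) i ∧ FitzLE T (x, η) j ∧ i + j + G (x, ξ + η) < ε by
    obtain ⟨x, ξ, η, i, j, h1, h2, h3⟩ := this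
    have h4 := hSqd.le_of_fitzLE h1
    have h5 := hTqd.le_of_fitzLE h2
    have h6 := hrQ (x, ξ + η)
    have h7 := rQ_nonneg (x, ξ + η) p
    simp only [add_apply] at h4 h5 h6
    exact ⟨(x, ξ + η), ⟨ξ, η, i, j, h1, h2, rfl, by linarith⟩, by linarith⟩
  by_contra! hcon
  have hGc : Continuous G := by
    have h1 : Continuous fun q : E × (E →L[ℝ] ℝ) => p.2 q.1 := by fun_prop
    have h2 : Continuous fun q : E × (E →L[ℝ] ℝ) => q.2 p.1 := by fun_prop
    fun_prop
  have hG : ConvexOn ℝ Set.univ G := by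
    have hsq : ∀ {F : Type _} [NormedAddCommGroup F] [NormedSpace ℝ F] (v : F),
        ConvexOn ℝ Set.univ fun w : F => 1 / 2 * ‖w - v‖ ^ 2 := by
      intro F _ _ v
      have h1 : ConvexOn ℝ Set.univ fun w : F => ‖w - v‖ := by
        simpa [dist_eq_norm] using convexOn_univ_dist v
      exact (h1.pow (fun _ _ => norm_nonneg _) 2).smul (by norm_num)
    have h1 : ConvexOn ℝ Set.univ fun q : E × (E →L[ℝ] ℝ) => 1 / 2 * ‖q.1 - p.1‖ ^ 2 :=
      (hsq p.1).comp_linearMap (LinearMap.fst ℝ E (E →L[ℝ] ℝ))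
    have h2 : ConvexOn ℝ Set.univ fun q : E × (E →L[ℝ] ℝ) => 1 / 2 * ‖q.2 - p.2‖ ^ 2 :=
      (hsq p.2).comp_linearMap (LinearMap.snd ℝ E (E →L[ℝ] ℝ))
    refine (h1.add h2).add ⟨convex_univ, fun q _ q' _ a b _ _ hab => le_of_eq ?_⟩
    have e : p.2 p.1 = a * p.2 p.1 + b * p.2 p.1 := by rw [← add_mul, hab, one_mul]
    simp only [Prod.fst_add, Prod.snd_add, Prod.smul_fst, Prod.smul_snd, add_apply, smul_apply,
      map_add, map_smul, smul_eq_mul]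
    linear_combination e
  obtain ⟨a, b, y, k, h1, h2⟩ := h.exists_dual hS hT hG hGc
    (M := 1 / 2 * (R + ‖p.1‖) ^ 2 + 1 / 2 * (2 * R + ‖p.2‖) ^ 2 +
      (‖p.2‖ * R + 2 * R * ‖p.1‖ + p.2 p.1)) (by
      intro x ζ hx hζ
      have h3 : ‖x - p.1‖ ≤ R + ‖p.1‖ := (norm_sub_le _ _).trans (by linarith)
      have h4 : ‖ζ - p.2‖ ≤ 2 * R + ‖p.2‖ := (norm_sub_le _ _).trans (by linarith)
      have h5 : (-p.2) x ≤ ‖p.2‖ * R := apply_le_of_norm_le (norm_neg _).le hx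
      have h6 : (-ζ) p.1 ≤ 2 * R * ‖p.1‖ :=
        apply_le_of_norm_le ((norm_neg _).trans_le hζ) le_rfl
      rw [neg_apply] at h5 h6
      have h7 := pow_le_pow_left₀ (norm_nonneg _) h3 2
      have h8 := pow_le_pow_left₀ (norm_nonneg _) h4 2
      simp only [G]
      linarith) hε.le hcon
  have hε8 : 0 < ε / 8 := by positivity
  let J : (E →L[ℝ] ℝ) →L[ℝ] ℝ := NormedSpace.inclusionInDoubleDual ℝ E p.1
  have hJ : ∀ ζ, J ζ = ζ p.1 := fun ζ => rfl
  obtain ⟨s, hs, hs'⟩ := hSqd.negativeInfimum a y hε8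
  obtain ⟨t, ht, ht'⟩ := hTqd.negativeInfimum b y hε8
  obtain ⟨v, hv⟩ := exists_half_norm_sq_add_le (a + b - p.2) hε8
  obtain ⟨g, hg⟩ := exists_half_norm_sq_add_le (y - J) hε8
  have h3 := h1 s hs t ht
  have h4 := h2 (p.1 + v) (p.2 + g)
  have h5 := half_norm_sq_add_apply_nonneg (y - J) (a + b - p.2)
  simp only [G, add_sub_cancel_left, add_apply, sub_apply, map_add, map_sub, hJ] at h4 h5 hv hg
  linarith


/-- Banach–Alaoglu along an ultrafilter. -/
lemma exists_tendsto_apply_of_norm_le {f : ℕ → E →L[ℝ] ℝ} {M : ℝ} (hM : ∀ n, ‖f n‖ ≤ M)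
    (U : Ultrafilter ℕ) : ∃ g : E →L[ℝ] ℝ, ∀ x, Tendsto (fun n => f n x) U (𝓝 (g x)) := by
  have hK := WeakDual.isCompact_closedBall (𝕜 := ℝ) (0 : StrongDual ℝ E) M
  obtain ⟨g, -, hg⟩ := hK.ultrafilter_le_nhds (U.map fun n => StrongDual.toWeakDual (f n)) (by
    rw [Ultrafilter.coe_map, le_principal_iff, mem_map]
    refine Filter.univ_mem' fun n => ?_
    simpa using hM n)
  refine ⟨WeakDual.toStrongDual g, fun x => ?_⟩
  exact ((WeakDual.eval_continuous x).tendsto g).comp hg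

lemma norm_le_div_of_apply_le {F : Type*} [NormedAddCommGroup F] [NormedSpace ℝ F]
    {f : F →L[ℝ] ℝ} {ρ C : ℝ} (hρ : 0 < ρ) (h : ∀ w, ‖w‖ ≤ ρ → f w ≤ C) : ‖f‖ ≤ C / ρ := by
  have hC : 0 ≤ C := by simpa using h 0 (by simpa using hρ.le)
  have key : ∀ w, f w ≤ C / ρ * ‖w‖ := by
    intro w
    rcases (norm_nonneg w).eq_or_lt' with h0 | hpos
    · simp [norm_eq_zero.1 h0]
    have h1 := h ((ρ / ‖w‖) • w) (by
      rw [norm_smul, Real.norm_of_nonneg (by positivity)]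
      field_simp; rfl)
    rw [map_smul, smul_eq_mul, div_mul_eq_mul_div, div_le_iff₀ hpos] at h1
    rw [div_mul_eq_mul_div, le_div_iff₀ hρ]
    linarith
  refine f.opNorm_le_bound (by positivity) fun w => ?_
  have h2 := key (-w)
  rw [map_neg, norm_neg] at h2
  exact abs_le.2 ⟨by linarith, key w⟩

lemma tendsto_apply_of_tendsto {f : ℕ → E →L[ℝ] ℝ} {M : ℝ} (hM : ∀ n, ‖f n‖ ≤ M)
    {l : Filter ℕ} {x : ℕ → E} {a : E} {c : ℝ} (hf : Tendsto (fun n => f n a) l (𝓝 c))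
    (hx : Tendsto x l (𝓝 a)) : Tendsto (fun n => f n (x n)) l (𝓝 c) := by
  have h1 : Tendsto (fun n => f n (x n - a)) l (𝓝 0) := by
    refine squeeze_zero_norm (fun n => (f n).le_of_opNorm_le (hM n) _) ?_
    simpa using (tendsto_iff_norm_sub_tendsto_zero.1 hx).const_mul M
  simpa using h1.add hf

lemma exists_forall_le_of_tendsto {u : ℕ → ℝ} {a : ℝ} (h : Tendsto u atTop (𝓝 a)) :
    ∃ M, ∀ n, u n ≤ M := by
  obtain ⟨M, hM⟩ := h.bddAbove_range
  exact ⟨M, fun n => hM ⟨n, rfl⟩⟩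

lemma Qualified.mem_sumSet_of_tendsto {S T : Set (E × (E →L[ℝ] ℝ))} {V : Submodule ℝ E} {ρ R : ℝ}
    (h : Qualified S T V ρ R) (hSc : IsClosed S) (hS : MonotoneSet S) (hSqd : Quasidense S)
    (hTc : IsClosed T) (hT : MonotoneSet T) (hTqd : Quasidense T) {p : E × (E →L[ℝ] ℝ)}
    {x : ℕ → E} {ξ η : ℕ → E →L[ℝ] ℝ} {i j : ℕ → ℝ}
    (hi : ∀ n, FitzLE S (x n, ξ n) (i n)) (hj : ∀ n, FitzLE T (x n, η n) (j n))
    (hi0 : Tendsto (fun n => i n - ξ n (x n)) atTop (𝓝 0))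
    (hj0 : Tendsto (fun n => j n - η n (x n)) atTop (𝓝 0))
    (hx : Tendsto x atTop (𝓝 p.1)) (hξη : Tendsto (fun n => ξ n + η n) atTop (𝓝 p.2)) :
    p ∈ sumSet S T := by
  obtain ⟨A, hA⟩ := exists_forall_le_of_tendsto hi0
  obtain ⟨B, hB⟩ := exists_forall_le_of_tendsto hj0
  obtain ⟨X, hX⟩ := exists_forall_le_of_tendsto hx.norm
  obtain ⟨Z, hZ⟩ := exists_forall_le_of_tendsto hξη.norm
  have hbound : ∀ n, ‖(ξ n).comp V.subtypeL‖ ≤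
      (2 * A + 2 * B + 4 * R + 2 * (R * R + R * X) + Z * (R + X)) / ρ := by
    refine fun n => norm_le_div_of_apply_le h.pos fun w hw => ?_
    obtain ⟨u, α, v, β, hu, hv, hun, hα, hvn, hβ, he⟩ := h.exists_sub_eq w w.2 hw
    have h1 := hSqd.neg_apply_sub_le (hi n) hu
    have h2 := hTqd.neg_apply_sub_le (hj n) hv
    have h3 : (-α) u ≤ R * R := apply_le_of_norm_le ((norm_neg _).trans_le hα) hun
    have h4 : (-α) (x n) ≤ R * X := apply_le_of_norm_le ((norm_neg _).trans_le hα) (hX n)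
    have h5 : (-β) v ≤ R * R := apply_le_of_norm_le ((norm_neg _).trans_le hβ) hvn
    have h6 : (-β) (x n) ≤ R * X := apply_le_of_norm_le ((norm_neg _).trans_le hβ) (hX n)
    have h7 : (ξ n + η n) (x n - v) ≤ Z * (R + X) :=
      apply_le_of_norm_le (hZ n) ((norm_sub_le _ _).trans (by linarith [hX n]))
    have h8 : ξ n w = ξ n u - ξ n v := by rw [← he, map_sub]
    simp only [map_sub, sub_apply, neg_apply, add_apply] at h1 h2 h3 h4 h5 h6 h7
    have h9 := hA n
    have h10 := hB n
    change ξ n w ≤ _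
    linarith
  choose ξ' hξ' hξ'n using fun n => exists_extension_norm_eq V ((ξ n).comp V.subtypeL)
  have hM := fun n => (hξ'n n).trans_le (hbound n)
  have hV : ∀ n, ∀ w ∈ V, ξ' n w = ξ n w := fun n w hw => hξ' n ⟨w, hw⟩
  let U := hyperfilter ℕ
  have hU : (U : Filter ℕ) ≤ atTop := Nat.hyperfilter_le_atTop
  obtain ⟨g, hg⟩ := exists_tendsto_apply_of_norm_le hM U
  have hgx := tendsto_apply_of_tendsto hM (hg p.1) (hx.mono_left hU)
  have happ : ∀ y, Tendsto (fun n => (ξ n + η n) y) U (𝓝 (p.2 y)) := fun y =>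
    (((ContinuousLinearMap.apply ℝ ℝ y).continuous.tendsto p.2).comp hξη).mono_left hU
  have happx : Tendsto (fun n => (ξ n + η n) (x n)) U (𝓝 (p.2 p.1)) :=
    tendsto_apply_of_tendsto hZ (happ p.1) (hx.mono_left hU)
  have hxs : ∀ s : E →L[ℝ] ℝ, Tendsto (fun n => s (x n)) U (𝓝 (s p.1)) := fun s =>
    ((s.continuous.tendsto p.1).comp hx).mono_left hU
  refine ⟨g, p.2 - g, hSqd.mem_of_fitzLE hSc fun s hs => ?_,
    hTqd.mem_of_fitzLE hTc fun t ht => ?_, by abel⟩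
  · have h1 := ((hg s.1).add (hxs s.2)).sub_const (s.2 s.1)
    have h2 := hgx.add (hi0.mono_left hU)
    rw [add_zero] at h2
    refine le_of_tendsto_of_tendsto' h1 h2 fun n => ?_
    have h3 := hi n s hs
    have h4 := hV n _ (h.sub_mem (hS.fitzLE hs) (hj n))
    simp only [map_sub] at h3 h4
    linarith
  · have h1 := (((happ t.1).sub (hg t.1)).add (hxs t.2)).sub_const (t.2 t.1)
    have h2 := (happx.sub hgx).add (hj0.mono_left hU)
    rw [add_zero] at h2
    refine le_of_tendsto_of_tendsto' h1 h2 fun n => ?_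
    have h3 := hj n t ht
    have h4 := hV n _ (h.sub_mem (hi n) (hT.fitzLE ht))
    simp only [map_sub, add_apply] at h3 h4 ⊢
    linarith

lemma ApproxSum.neg_apply_sub_le {S T : Set (E × (E →L[ℝ] ℝ))} (hSqd : Quasidense S)
    (hTqd : Quasidense T) {δ δ' : ℝ} {p q : E × (E →L[ℝ] ℝ)} (hp : ApproxSum S T δ p)
    (hq : ApproxSum S T δ' q) : -(p.2 - q.2) (p.1 - q.1) ≤ 2 * δ + 2 * δ' := by
  obtain ⟨ξ, η, i, j, h1, h2, h3, h4⟩ := hp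
  obtain ⟨ξ', η', i', j', h1', h2', h3', h4'⟩ := hq
  have h5 := hSqd.neg_apply_sub_le h1 h1'
  have h6 := hTqd.neg_apply_sub_le h2 h2'
  rw [← h3, ← h3']
  simp only [map_sub, add_apply, sub_apply] at h5 h6 ⊢
  linarith

lemma MonotoneSet.approxSum {S T : Set (E × (E →L[ℝ] ℝ))} (hS : MonotoneSet S)
    (hT : MonotoneSet T) {p : E × (E →L[ℝ] ℝ)} (hp : p ∈ sumSet S T) : ApproxSum S T 0 p := by
  obtain ⟨s, t, hs, ht, h⟩ := hp
  exact ⟨s, t, s p.1, t p.1, hS.fitzLE hs, hT.fitzLE ht, h.symm, by simp⟩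

lemma dist_le_of_rQ_le {p q : E × (E →L[ℝ] ℝ)} {a b c : ℝ} (hc : 0 ≤ c) (h1 : rQ q p ≤ a)
    (h2 : -(q.2 - p.2) (q.1 - p.1) ≤ b) (h : 2 * (a + b) ≤ c ^ 2) : dist q p ≤ c := by
  unfold rQ at h1
  have h3 : ‖q.1 - p.1‖ ≤ c :=
    le_of_sq_le_sq (by nlinarith [sq_nonneg ‖q.2 - p.2‖]) hc
  have h4 : ‖q.2 - p.2‖ ≤ c :=
    le_of_sq_le_sq (by nlinarith [sq_nonneg ‖q.1 - p.1‖]) hc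
  rw [Prod.dist_eq, dist_eq_norm, dist_eq_norm]
  exact max_le h3 h4

lemma Qualified.mem_sumSet_of_approxSum {S T : Set (E × (E →L[ℝ] ℝ))} {V : Submodule ℝ E}
    {ρ R : ℝ} (h : Qualified S T V ρ R) (hSc : IsClosed S) (hS : MonotoneSet S)
    (hSqd : Quasidense S) (hTc : IsClosed T) (hT : MonotoneSet T) (hTqd : Quasidense T)
    {p : E × (E →L[ℝ] ℝ)} {q : ℕ → E × (E →L[ℝ] ℝ)} {δ : ℕ → ℝ}
    (hq : ∀ n, ApproxSum S T (δ n) (q n)) (hδ : Tendsto δ atTop (𝓝 0))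
    (hqp : Tendsto q atTop (𝓝 p)) : p ∈ sumSet S T := by
  choose ξ η i j h1 h2 h3 h4 using hq
  have h5 := fun n => hSqd.le_of_fitzLE (h1 n)
  have h6 := fun n => hTqd.le_of_fitzLE (h2 n)
  simp only at h5 h6
  refine h.mem_sumSet_of_tendsto hSc hS hSqd hTc hT hTqd h1 h2
    (squeeze_zero (fun n => sub_nonneg.2 (h5 n)) (fun n => ?_) hδ)
    (squeeze_zero (fun n => sub_nonneg.2 (h6 n)) (fun n => ?_) hδ)
    ((continuous_fst.tendsto p).comp hqp) ?_
  · linarith [h4 n, h6 n]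
  · linarith [h4 n, h5 n]
  · simp only [h3]
    exact (continuous_snd.tendsto p).comp hqp

/-- Approximate elements of the sum are close to elements of the sum. -/
lemma Qualified.exists_mem_sumSet_dist_le [CompleteSpace E] {S T : Set (E × (E →L[ℝ] ℝ))}
    {V : Submodule ℝ E} {ρ R : ℝ} (h : Qualified S T V ρ R) (hSc : IsClosed S)
    (hS : MonotoneSet S) (hSqd : Quasidense S) (hTc : IsClosed T) (hT : MonotoneSet T)
    (hTqd : Quasidense T) {ε : ℝ} (hε : 0 < ε) {q₀ : E × (E →L[ℝ] ℝ)}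
    (hq₀ : ApproxSum S T (ε ^ 2) q₀) : ∃ p ∈ sumSet S T, dist q₀ p ≤ 6 * ε := by
  choose! g hg hgr using fun (q : E × (E →L[ℝ] ℝ)) (δ : ℝ) (hδ : 0 < δ) =>
    h.exists_approxSum hS hT hSqd hTqd q hδ
  let q : ℕ → E × (E →L[ℝ] ℝ) := fun n => Nat.rec q₀ (fun n q => g q (ε ^ 2 / 4 ^ (n + 1))) n
  have hq : ∀ n, ApproxSum S T (ε ^ 2 / 4 ^ n) (q n) := by
    intro n
    cases n with
    | zero =>
      rw [pow_zero, div_one]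
      exact hq₀
    | succ n => exact hg _ _ (by positivity)
  have hd : ∀ n, dist (q n) (q (n + 1)) ≤ 6 * ε / 2 / 2 ^ n := by
    intro n
    rw [dist_comm]
    refine dist_le_of_rQ_le (by positivity) (hgr (q n) (ε ^ 2 / 4 ^ (n + 1)) (by positivity))
      ((hq (n + 1)).neg_apply_sub_le hSqd hTqd (hq n)) ?_
    have e : (4 : ℝ) ^ n = (2 ^ n) ^ 2 := by rw [← pow_mul, mul_comm, pow_mul]; norm_num
    rw [pow_succ (4 : ℝ) n, e, div_pow]
    field_simp
    norm_num
  obtain ⟨p, hp⟩ := cauchySeq_tendsto_of_complete (cauchySeq_of_le_geometric_two hd)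
  refine ⟨p, h.mem_sumSet_of_approxSum hSc hS hSqd hTc hT hTqd hq ?_ hp,
    dist_le_of_le_geometric_two_of_tendsto₀ hd hp⟩
  exact tendsto_const_nhds.div_atTop (tendsto_pow_atTop_atTop_of_one_lt (by norm_num))

/-- Points `q` with `rQ q p` bounded and monotonically related, up to a constant, to a fixed point
stay bounded. -/
lemma exists_norm_sub_le_of_rQ_le (s p : E × (E →L[ℝ] ℝ)) :
    ∃ K, 0 ≤ K ∧ ∀ q : E × (E →L[ℝ] ℝ), -(q.2 - s.2) (q.1 - s.1) ≤ 4 → rQ q p ≤ 1 →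
      ‖q.1 - p.1‖ ≤ K ∧ ‖q.2 - p.2‖ ≤ K := by
  set d := ‖p.1 - s.1‖ with hd
  set d' := ‖p.2 - s.2‖ with hd'
  have hd0 : 0 ≤ d := norm_nonneg _
  have hd0' : 0 ≤ d' := norm_nonneg _
  refine ⟨4 + 3 * (d + d'), by positivity, fun q h1 h2 => ?_⟩
  have h3 : (q.2 - p.2) (p.1 - s.1) ≤ ‖q.2 - p.2‖ * d := apply_le_of_norm_le le_rfl le_rfl
  have h4 : (p.2 - s.2) (q.1 - p.1) ≤ d' * ‖q.1 - p.1‖ := apply_le_of_norm_le le_rfl le_rfl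
  have h5 : (p.2 - s.2) (p.1 - s.1) ≤ d' * d := apply_le_of_norm_le le_rfl le_rfl
  unfold rQ at h2
  have h6 : 1 / 2 * ‖q.1 - p.1‖ ^ 2 + 1 / 2 * ‖q.2 - p.2‖ ^ 2 ≤
      5 + ‖q.2 - p.2‖ * d + d' * ‖q.1 - p.1‖ + d' * d := by
    simp only [map_sub, sub_apply] at h1 h2 h3 h4 h5
    linarith
  have h7 := norm_nonneg (q.1 - p.1)
  have h8 := norm_nonneg (q.2 - p.2)
  have h9 : (‖q.1 - p.1‖ - d') ^ 2 + (‖q.2 - p.2‖ - d) ^ 2 ≤ (4 + (d + d')) ^ 2 := by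
    linarith
  have h10 : ‖q.1 - p.1‖ - d' ≤ 4 + (d + d') :=
    le_of_sq_le_sq (by linarith [sq_nonneg (‖q.2 - p.2‖ - d)]) (by positivity)
  have h11 : ‖q.2 - p.2‖ - d ≤ 4 + (d + d') :=
    le_of_sq_le_sq (by linarith [sq_nonneg (‖q.1 - p.1‖ - d')]) (by positivity)
  constructor <;> linarith

lemma rQ_le_of_dist_le {p q q' : E × (E →L[ℝ] ℝ)} {K δ : ℝ} (h1 : ‖q.1 - p.1‖ ≤ K)
    (h2 : ‖q.2 - p.2‖ ≤ K) (h : dist q q' ≤ δ) :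
    rQ q' p ≤ rQ q p + 4 * K * δ + 2 * δ ^ 2 := by
  have h0 := h
  rw [dist_comm, Prod.dist_eq, dist_eq_norm, dist_eq_norm, max_le_iff] at h0
  obtain ⟨h3, h4⟩ := h0
  have hK : 0 ≤ K := (norm_nonneg _).trans h1
  have hδ : 0 ≤ δ := (norm_nonneg _).trans h3
  have e1 : q'.1 - p.1 = (q.1 - p.1) + (q'.1 - q.1) := by abel
  have e2 : q'.2 - p.2 = (q.2 - p.2) + (q'.2 - q.2) := by abel
  have h5 : (q.2 - p.2) (q'.1 - q.1) ≤ K * δ := apply_le_of_norm_le h2 h3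
  have h6 : (q'.2 - q.2) (q.1 - p.1) ≤ δ * K := apply_le_of_norm_le h4 h1
  have h7 : (q'.2 - q.2) (q'.1 - q.1) ≤ δ * δ := apply_le_of_norm_le h4 h3
  have key : ∀ {a b c : ℝ}, 0 ≤ a → a ≤ K → 0 ≤ c → c ≤ a + b → b ≤ δ →
      c ^ 2 ≤ a ^ 2 + 2 * (K * δ) + δ ^ 2 := by
    intro a b c ha haK hc hcab hb
    have : c ^ 2 ≤ (a + δ) ^ 2 := pow_le_pow_left₀ hc (by linarith) 2
    nlinarith [mul_le_mul_of_nonneg_right haK hδ]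
  have h8 := key (norm_nonneg _) h1 (norm_nonneg _) (e1 ▸ norm_add_le (q.1 - p.1) (q'.1 - q.1)) h3
  have h9 := key (norm_nonneg _) h2 (norm_nonneg _) (e2 ▸ norm_add_le (q.2 - p.2) (q'.2 - q.2)) h4
  have h10 : (q'.2 - p.2) (q'.1 - p.1) = (q.2 - p.2) (q.1 - p.1) + (q.2 - p.2) (q'.1 - q.1) +
      (q'.2 - q.2) (q.1 - p.1) + (q'.2 - q.2) (q'.1 - q.1) := by
    simp only [map_sub, sub_apply]
    ring
  unfold rQ
  linarith

lemma MonotoneSet.monotoneSet_sumSet {S T : Set (E × (E →L[ℝ] ℝ))} (hS : MonotoneSet S)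
    (hT : MonotoneSet T) (hne : (sumSet S T).Nonempty) : MonotoneSet (sumSet S T) := by
  refine ⟨hne, ?_⟩
  rintro p ⟨s, t, hs, ht, hp⟩ q ⟨s', t', hs', ht', hq⟩
  have h1 := hS.2 _ hs _ hs'
  have h2 := hT.2 _ ht _ ht'
  rw [hp, hq]
  simp only [map_sub, sub_apply, add_apply] at h1 h2 ⊢
  linarith

lemma iInf_coe_nonpos {α : Type*} {A : Set α} {f : α → ℝ} (h : ∀ η > 0, ∃ q ∈ A, f q ≤ η) :
    (⨅ q ∈ A, ((f q : ℝ) : EReal)) ≤ 0 := by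
  by_contra! hlt
  obtain ⟨η, h0, hη⟩ := EReal.lt_iff_exists_real_btwn.1 hlt
  obtain ⟨q, hq, hle⟩ := h η (by exact_mod_cast h0)
  exact hη.not_ge ((iInf₂_le q hq).trans (by exact_mod_cast hle))

theorem statement13 [CompleteSpace E] [Nontrivial E]
    (S T : Set (E × (E →L[ℝ] ℝ)))
    (hSclosed : IsClosed S) (hSmono : MonotoneSet S) (hSqd : Quasidense S)
    (hTclosed : IsClosed T) (hTmono : MonotoneSet T) (hTqd : Quasidense T)
    (V : Submodule ℝ E) (hVclosed : IsClosed (V : Set E))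
    (hV : (⋃ l ∈ Set.Ioi (0 : ℝ), l • (proj1domFitz S - proj1domFitz T)) = (V : Set E)) :
    IsClosed (sumSet S T) ∧ MonotoneSet (sumSet S T) ∧ StablyQuasidense (sumSet S T) := by
  obtain ⟨ρ, R, h⟩ := exists_qualified hVclosed hV
  have happrox := fun p {ε : ℝ} (hε : 0 < ε) =>
    h.exists_approxSum hSmono hTmono hSqd hTqd p hε
  have hnear := fun {ε : ℝ} (hε : 0 < ε) {q} (hq : ApproxSum S T (ε ^ 2) q) =>
    h.exists_mem_sumSet_dist_le hSclosed hSmono hSqd hTclosed hTmono hTqd hε hq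
  obtain ⟨s₀, hs₀⟩ : (sumSet S T).Nonempty := by
    obtain ⟨q, hq, -⟩ := happrox 0 (show (0 : ℝ) < 1 ^ 2 by norm_num)
    obtain ⟨p, hp, -⟩ := hnear one_pos hq
    exact ⟨p, hp⟩
  refine ⟨IsSeqClosed.isClosed fun q p hq hqp => ?_, hSmono.monotoneSet_sumSet hTmono ⟨s₀, hs₀⟩,
    fun p => ?_⟩
  · exact h.mem_sumSet_of_approxSum hSclosed hSmono hSqd hTclosed hTmono hTqd
      (fun n => hSmono.approxSum hTmono (hq n)) tendsto_const_nhds hqp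
  obtain ⟨K, hK, hKb⟩ := exists_norm_sub_le_of_rQ_le s₀ p
  refine ⟨2 * (K + 1), by positivity, iInf_coe_nonpos fun η hη => ?_⟩
  obtain ⟨ε, hε, hε6, hεη⟩ : ∃ ε : ℝ, 0 < ε ∧ ε ≤ 1 / 6 ∧ (73 + 24 * K) * ε ≤ η := by
    refine ⟨min (1 / 6) (η / (73 + 24 * K)), by positivity, min_le_left _ _, ?_⟩
    calc (73 + 24 * K) * min (1 / 6) (η / (73 + 24 * K))
        ≤ (73 + 24 * K) * (η / (73 + 24 * K)) := by gcongr; exact min_le_right _ _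
      _ = η := by field_simp
  have hεε : ε ^ 2 ≤ ε := by nlinarith
  obtain ⟨q, hq, hqp⟩ := happrox p (show 0 < ε ^ 2 by positivity)
  obtain ⟨q', hq', hd⟩ := hnear hε hq
  have h1 := hq.neg_apply_sub_le hSqd hTqd (hSmono.approxSum hTmono hs₀)
  obtain ⟨h2, h3⟩ := hKb q (by linarith) (by linarith)
  refine ⟨q', ⟨hq', ?_⟩, ?_⟩
  · have h4 : dist q' q ≤ 1 := by rw [dist_comm]; linarith
    rw [Prod.dist_eq, dist_eq_norm, dist_eq_norm, max_le_iff] at h4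
    have h5 : ‖q'.1 - p.1‖ ≤ K + 1 :=
      (norm_sub_le_norm_sub_add_norm_sub _ q.1 _).trans (by linarith [h4.1])
    have h6 : ‖q'.2 - p.2‖ ≤ K + 1 :=
      (norm_sub_le_norm_sub_add_norm_sub _ q.2 _).trans (by linarith [h4.2])
    refine Real.sqrt_le_iff.2 ⟨by positivity, ?_⟩
    nlinarith [pow_le_pow_left₀ (norm_nonneg _) h5 2, pow_le_pow_left₀ (norm_nonneg _) h6 2]
  · have h4 := rQ_le_of_dist_le h2 h3 hd
    nlinarith
end
end

section
/- Let A be a closed L-positive linear subspace of B and let A⁰ := { b* ∈ B* : ⟨a, b*⟩ = 0 for all a ∈ A } be its polar subspace. Then A is r_L-dense in B if and only if s_L(b*) ≤ 0 for every b* ∈ A⁰. -/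
noncomputable section

variable {B : Type*} [NormedAddCommGroup B] [NormedSpace ℝ B]

/-- The quadratic form `q_L b = (1/2)⟨b, Lb⟩` of a Banach SN space. -/
def qL (L : B →L[ℝ] (B →L[ℝ] ℝ)) (b : B) : ℝ := (1 / 2) * L b b

/-- `r_L = (1/2)‖·‖² + q_L`. -/
def rL (L : B →L[ℝ] (B →L[ℝ] ℝ)) (b : B) : ℝ := (1 / 2) * ‖b‖ ^ 2 + qL L b

/-- `L` is an SN map: `‖L‖ ≤ 1` and `⟨b, Lc⟩ = ⟨c, Lb⟩`. -/
def IsSN (L : B →L[ℝ] (B →L[ℝ] ℝ)) : Prop := ‖L‖ ≤ 1 ∧ ∀ b c : B, L c b = L b c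

/-- `f` is a proper convex function `B → (-∞, ∞]` with `f ≥ q_L` on `B`. -/
def PCq (L : B →L[ℝ] (B →L[ℝ] ℝ)) (f : B → EReal) : Prop :=
  (∃ b, f b ≠ ⊤) ∧
  (∀ x y : B, ∀ t : ℝ, 0 ≤ t → t ≤ 1 →
    f (t • x + (1 - t) • y) ≤ (t : EReal) * f x + ((1 - t : ℝ) : EReal) * f y) ∧
  ∀ b, (qL L b : EReal) ≤ f b

/-- The Fenchel conjugate `f*(b*) = sup_b [⟨b, b*⟩ - f b]`. -/
def fconj (f : B → EReal) (p : B →L[ℝ] ℝ) : EReal := ⨆ b : B, ((p b : ℝ) : EReal) - f b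

/-- `f⊛(b) := f*(Lb)`. -/
def fconjL (L : B →L[ℝ] (B →L[ℝ] ℝ)) (f : B → EReal) (b : B) : EReal := fconj f (L b)

/-- `A` is an `L`-positive subset of `B`. -/
def LPositive (L : B →L[ℝ] (B →L[ℝ] ℝ)) (A : Set B) : Prop :=
  A.Nonempty ∧ ∀ a ∈ A, ∀ c ∈ A, 0 ≤ qL L (a - c)

/-- `A` is maximally `L`-positive. -/
def MaxLPositive (L : B →L[ℝ] (B →L[ℝ] ℝ)) (A : Set B) : Prop :=
  LPositive L A ∧ ∀ A' : Set B, LPositive L A' → A ⊆ A' → A' = A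

/-- `A` is `r_L`-dense in `B`: for all `c`, `inf_{a ∈ A} r_L(a - c) ≤ 0`. -/
def RDense (L : B →L[ℝ] (B →L[ℝ] ℝ)) (A : Set B) : Prop :=
  ∀ c : B, (⨅ a ∈ A, ((rL L (a - c) : ℝ) : EReal)) ≤ 0

/-- `A` is stably `r_L`-dense in `B`. -/
def StablyRDense (L : B →L[ℝ] (B →L[ℝ] ℝ)) (A : Set B) : Prop :=
  ∀ c : B, ∃ K : ℝ, 0 ≤ K ∧
    (⨅ a ∈ {a ∈ A | ‖a - c‖ ≤ K}, ((rL L (a - c) : ℝ) : EReal)) ≤ 0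

/-- `f` is touching. -/
def Touching (L : B →L[ℝ] (B →L[ℝ] ℝ)) (f : B → EReal) : Prop :=
  PCq L f ∧
    ∀ c : B, (⨅ d : B, ((f d - (qL L d : EReal)) + ((rL L (d - c) : ℝ) : EReal))) ≤ 0

/-- The function `s_L` on `B*`. -/
def sL (L : B →L[ℝ] (B →L[ℝ] ℝ)) (p : B →L[ℝ] ℝ) : EReal :=
  ⨆ c : B, ((p c - qL L c - (1 / 2) * ‖L c - p‖ ^ 2 : ℝ) : EReal)

/-- The Fitzpatrick-type function `Φ_A`. -/
def PhiA (L : B →L[ℝ] (B →L[ℝ] ℝ)) (A : Set B) (b : B) : EReal :=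
  ⨆ a ∈ A, ((L b a - qL L a : ℝ) : EReal)

/-- `Θ_A` on `B*`. -/
def ThetaA (L : B →L[ℝ] (B →L[ℝ] ℝ)) (A : Set B) (p : B →L[ℝ] ℝ) : EReal :=
  ⨆ a ∈ A, ((p a - qL L a : ℝ) : EReal)

lemma qL_sub {L : B →L[ℝ] (B →L[ℝ] ℝ)} (hL : ∀ b c : B, L c b = L b c) (a c : B) :
    qL L (a - c) = qL L a - L c a + qL L c := by
  simp only [qL, map_sub, sub_apply, hL c a]
  ring

lemma qL_le_half_norm_sq {L : B →L[ℝ] (B →L[ℝ] ℝ)} (hL : ‖L‖ ≤ 1) (a : B) :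
    qL L a ≤ 1 / 2 * ‖a‖ ^ 2 := by
  have h := (le_abs_self _).trans (L.le_opNorm₂ a a)
  have h' : ‖L‖ * ‖a‖ * ‖a‖ ≤ 1 * ‖a‖ * ‖a‖ := by gcongr
  unfold qL
  nlinarith

/-- A quadratic form that is nonnegative on a subspace is convex along its translates. -/
lemma convexOn_qL_sub {L : B →L[ℝ] (B →L[ℝ] ℝ)} (hL : ∀ b c : B, L c b = L b c)
    {A : Submodule ℝ B} (hA : ∀ a ∈ A, 0 ≤ qL L a) (c : B) :
    ConvexOn ℝ (A : Set B) (fun a => qL L (a - c)) := by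
  refine ⟨A.convex, fun x hx y hy s t hs ht hst => ?_⟩
  have h := hA _ (A.sub_mem hx hy)
  obtain rfl : t = 1 - s := by linarith
  simp only [qL_sub hL] at h ⊢
  simp only [qL, map_add, map_smul, add_apply, smul_apply, smul_eq_mul, hL x y] at h ⊢
  nlinarith [mul_nonneg (mul_nonneg hs ht) h]

/-- Fenchel duality in sandwich form, for a convex function on a convex set and a continuous
convex function. -/
lemma exists_clm_sandwich {A : Set B} (hA : A.Nonempty) {φ g : B → ℝ} (hφ : ConvexOn ℝ A φ)
    (hg : ConvexOn ℝ Set.univ g) (hgc : Continuous g) {m : ℝ} (hm : ∀ a ∈ A, m ≤ φ a + g a) :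
    ∃ x : B →L[ℝ] ℝ, ∀ a ∈ A, ∀ b, m + x (a - b) ≤ φ a + g b := by
  have hS : Convex ℝ {z : B × ℝ | g z.1 < z.2} := by
    simpa using hg.convex_strict_epigraph
  have hSo : IsOpen {z : B × ℝ | g z.1 < z.2} :=
    isOpen_lt (hgc.comp continuous_fst) continuous_snd
  have hT : Convex ℝ {z : B × ℝ | z.1 ∈ A ∧ z.2 ≤ m - φ z.1} :=
    ((concaveOn_const m hφ.1).sub hφ).convex_hypograph
  have hd : Disjoint {z : B × ℝ | g z.1 < z.2} {z : B × ℝ | z.1 ∈ A ∧ z.2 ≤ m - φ z.1} := by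
    refine Set.disjoint_left.2 fun z hz hz' => ?_
    have h1 := hm _ hz'.1
    have h2 := hz'.2
    have h3 : g z.1 < z.2 := hz
    linarith
  obtain ⟨f, u, hfS, hfT⟩ := geometric_hahn_banach_open hS hSo hT hd
  have hf : ∀ b r, f (b, r) = f (b, 0) + r * f (0, 1) := fun b r => by
    rw [← smul_eq_mul, ← map_smul, ← map_add]
    simp
  have key : ∀ a ∈ A, ∀ b r, g b < r →
      f (b, 0) + r * f (0, 1) < f (a, 0) + (m - φ a) * f (0, 1) := fun a ha b r hr => by
    rw [← hf, ← hf]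
    exact (hfS (b, r) hr).trans_le (hfT (a, m - φ a) ⟨ha, le_rfl⟩)
  have hk : f (0, 1) < 0 := by
    obtain ⟨a, ha⟩ := hA
    have h1 := key a ha a (g a + 1) (by linarith)
    have h2 := hm a ha
    by_contra! h
    nlinarith
  refine ⟨(f (0, 1))⁻¹ • f.comp (ContinuousLinearMap.inl ℝ B ℝ), fun a ha b => ?_⟩
  refine le_of_forall_pos_le_add fun ε hε => ?_
  have h := key a ha b (g b + ε) (by linarith)
  have hx : f (a - b, 0) = f (a, 0) - f (b, 0) := by
    rw [← map_sub]
    simp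
  have h' : (f (0, 1))⁻¹ * f (a - b, 0) ≤ g b + ε - (m - φ a) := by
    rw [inv_mul_eq_div, div_le_iff_of_neg hk, hx]
    linarith
  simp only [smul_apply, ContinuousLinearMap.comp_apply,
    ContinuousLinearMap.inl_apply, smul_eq_mul]
  linarith

lemma half_norm_sq_le_of_forall {x : B →L[ℝ] ℝ} {M : ℝ}
    (h : ∀ v, x v - 1 / 2 * ‖v‖ ^ 2 ≤ M) : 1 / 2 * ‖x‖ ^ 2 ≤ M := by
  have hM : 0 ≤ M := by simpa using h 0
  have hx : ‖x‖ ≤ √(2 * M) := by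
    refine x.opNorm_le_bound (Real.sqrt_nonneg _) fun v => ?_
    refine abs_le_of_sq_le_sq ?_ (by positivity)
    rw [mul_pow, Real.sq_sqrt (by positivity)]
    have hdisc := discrim_le_zero (a := 1 / 2 * ‖v‖ ^ 2) (b := -x v) (c := M) fun t => by
      have := h (t • v)
      rw [map_smul, norm_smul, mul_pow, Real.norm_eq_abs, sq_abs, smul_eq_mul] at this
      linarith
    unfold discrim at hdisc
    linarith
  have := Real.sq_sqrt (show 0 ≤ 2 * M by positivity)
  nlinarith [norm_nonneg x, Real.sqrt_nonneg (2 * M)]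

/-- If `y - q_L` is bounded above on a subspace, then it has approximate critical points there. -/
lemma exists_approx_critical {L : B →L[ℝ] (B →L[ℝ] ℝ)} (hL : IsSN L) {A : Submodule ℝ B}
    {y : B →L[ℝ] ℝ} {K : ℝ} (hK : ∀ a ∈ A, y a - qL L a ≤ K) {δ : ℝ} (hδ : 0 < δ) :
    ∃ a₀ ∈ A, ∃ e : B →L[ℝ] ℝ, ‖e‖ ≤ δ ∧ (∀ a ∈ A, e a = y a - L a₀ a) ∧ |e a₀| ≤ δ := by
  have hK0 : 0 ≤ K := by simpa [qL] using hK 0 A.zero_mem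
  obtain ⟨ε, hε, hε1, hεδ⟩ : ∃ ε : ℝ, 0 < ε ∧ ε ≤ 1 ∧ ε * (8 * K + 16) ≤ δ ^ 2 := by
    refine ⟨min 1 (δ ^ 2 / (8 * K + 16)), by positivity, min_le_left _ _, ?_⟩
    rw [← le_div_iff₀ (by positivity)]
    exact min_le_right _ _
  set s : Set ℝ := (fun a => y a - qL L a) '' A
  have hs : s.Nonempty := ⟨_, 0, A.zero_mem, rfl⟩
  have hsb : BddAbove s := ⟨K, by rintro _ ⟨a, ha, rfl⟩; exact hK a ha⟩
  obtain ⟨_, ⟨a₀, ha₀, rfl⟩, hmax⟩ := exists_lt_of_lt_csSup hs (sub_lt_self (sSup s) hε)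
  have hvar : ∀ a ∈ A, ∀ t : ℝ, 0 ≤ qL L a * (t * t) + -(y a - L a₀ a) * t + ε := by
    intro a ha t
    have h := le_csSup hsb ⟨a₀ + t • a, A.add_mem ha₀ (A.smul_mem t ha), rfl⟩
    simp only [qL, map_add, map_smul, add_apply, smul_apply, smul_eq_mul, hL.2 a₀ a] at h hmax ⊢
    linarith
  have hw : ∀ a ∈ A, (y a - L a₀ a) ^ 2 ≤ 4 * qL L a * ε := fun a ha => by
    have := discrim_le_zero (hvar a ha)
    unfold discrim at this
    linarith
  obtain ⟨e, heA, hen⟩ := exists_extension_norm_eq A ((y - L a₀).comp A.subtypeL)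
  have he : ∀ a ∈ A, e a = y a - L a₀ a := fun a ha => by simpa using heA ⟨a, ha⟩
  refine ⟨a₀, ha₀, e, ?_, he, ?_⟩
  · rw [hen]
    refine ContinuousLinearMap.opNorm_le_bound _ hδ.le fun a => ?_
    refine abs_le_of_sq_le_sq ?_ (by positivity)
    have h1 := hw a a.2
    have h2 := qL_le_half_norm_sq hL.1 (a : B)
    have h3 : 2 * ε ≤ δ ^ 2 := by nlinarith
    calc ((y - L a₀).comp A.subtypeL a) ^ 2 = (y a - L a₀ a) ^ 2 := by simp
      _ ≤ 4 * qL L a * ε := h1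
      _ ≤ 4 * (1 / 2 * ‖(a : B)‖ ^ 2) * ε := by gcongr
      _ = 2 * ε * ‖(a : B)‖ ^ 2 := by ring
      _ ≤ δ ^ 2 * ‖(a : B)‖ ^ 2 := by gcongr
      _ = (δ * ‖a‖) ^ 2 := by rw [mul_pow]; rfl
  · rw [he a₀ ha₀]
    refine abs_le_of_sq_le_sq ?_ hδ.le
    have h1 := hw a₀ ha₀
    have h2 := hvar a₀ ha₀ (-(1 / 2))
    have h3 := hK a₀ ha₀
    have h4 : L a₀ a₀ = 2 * qL L a₀ := by unfold qL; ring
    have h5 : qL L a₀ ≤ 2 * K + 4 * ε := by linarith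
    nlinarith

/-- If `A` is `r_L`-dense and `q_L ≥ 0` on `A`, then `s_L ≤ 0` on the polar of `A`. -/
lemma RDense.sL_nonpos {L : B →L[ℝ] (B →L[ℝ] ℝ)} (hL : IsSN L) {A : Set B}
    (hA : ∀ a ∈ A, 0 ≤ qL L a) (hd : RDense L A) {p : B →L[ℝ] ℝ} (hp : ∀ a ∈ A, p a = 0) :
    sL L p ≤ 0 := by
  refine iSup_le fun c => ?_
  rw [← EReal.coe_zero, EReal.coe_le_coe_iff]
  refine le_of_forall_pos_le_add fun ε hε => ?_
  have hlt : (⨅ a ∈ A, ((rL L (a - c) : ℝ) : EReal)) < (ε : EReal) :=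
    (hd c).trans_lt (by exact_mod_cast hε)
  simp only [iInf_lt_iff, EReal.coe_lt_coe_iff] at hlt
  obtain ⟨a, ha, hac⟩ := hlt
  rw [rL, qL_sub hL.2] at hac
  have h1 := (le_abs_self _).trans ((L c - p).le_opNorm (a - c))
  have h2 := two_mul_le_add_sq ‖L c - p‖ ‖a - c‖
  have h3 : (L c - p) (a - c) = L c a - 2 * qL L c + p c := by
    simp only [qL, map_sub, sub_apply, hp a ha]
    ring
  have h4 := hA a ha
  linarith

/-- If `s_L ≤ 0` on the polar of a subspace `A` on which `q_L ≥ 0`, then `A` is `r_L`-dense. -/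
lemma rDense_of_sL_nonpos {L : B →L[ℝ] (B →L[ℝ] ℝ)} (hL : IsSN L) {A : Submodule ℝ B}
    (hA : ∀ a ∈ A, 0 ≤ qL L a)
    (hs : ∀ p : B →L[ℝ] ℝ, (∀ a ∈ A, p a = 0) → sL L p ≤ 0) : RDense L (A : Set B) := by
  intro c
  by_contra! hc
  obtain ⟨m, hm0, hm⟩ := EReal.lt_iff_exists_real_btwn.1 hc
  have hm0 : 0 < m := by exact_mod_cast hm0
  have hm : ∀ a ∈ A, m ≤ qL L (a - c) + 1 / 2 * ‖a - c‖ ^ 2 := fun a ha => by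
    have h : (m : EReal) ≤ (rL L (a - c) : ℝ) := hm.le.trans (iInf₂_le a ha)
    rw [EReal.coe_le_coe_iff, rL] at h
    linarith
  have hg : ConvexOn ℝ Set.univ (fun b : B => 1 / 2 * ‖b - c‖ ^ 2) := by
    have h := ((convexOn_univ_norm (E := B)).translate_left (-c)).pow
      (fun _ _ => norm_nonneg _) 2
    simpa [Function.comp_def, sub_eq_add_neg] using h.smul (show (0 : ℝ) ≤ 1 / 2 by norm_num)
  obtain ⟨x, hx⟩ := exists_clm_sandwich ⟨0, A.zero_mem⟩ (convexOn_qL_sub hL.2 hA c) hg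
    (by fun_prop) hm
  have hK : ∀ a ∈ A, (L c + x) a - qL L a ≤ qL L c + x c - 1 / 2 * ‖x‖ ^ 2 - m := by
    intro a ha
    have h : 1 / 2 * ‖x‖ ^ 2 ≤ qL L (a - c) - m - x (a - c) := by
      refine half_norm_sq_le_of_forall fun v => ?_
      have := hx a ha (c - v)
      simp only [map_sub, sub_sub_cancel_left, norm_neg] at this ⊢
      linarith
    rw [qL_sub hL.2, map_sub] at h
    rw [add_apply]
    linarith
  obtain ⟨δ, hδ, hδ1, hδm⟩ : ∃ δ : ℝ, 0 < δ ∧ δ ≤ 1 ∧ δ * (‖c‖ + ‖x‖ + 2) ≤ m := by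
    refine ⟨min 1 (m / (‖c‖ + ‖x‖ + 2)), by positivity, min_le_left _ _, ?_⟩
    rw [← le_div_iff₀ (by positivity)]
    exact min_le_right _ _
  obtain ⟨a₀, ha₀, e, hen, he, hea⟩ := exists_approx_critical hL hK hδ
  have hs' := (le_iSup _ (c - a₀)).trans (hs (L c + x - L a₀ - e) fun a ha => by
    simp only [sub_apply, he a ha]
    ring)
  rw [← EReal.coe_zero, EReal.coe_le_coe_iff, qL_sub hL.2,
    show L (c - a₀) - (L c + x - L a₀ - e) = e - x by rw [map_sub]; abel] at hs'
  have h1 := hK a₀ ha₀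
  have h2 := he a₀ ha₀
  have h3 : ‖e - x‖ ^ 2 ≤ (δ + ‖x‖) ^ 2 := by
    gcongr
    exact (norm_sub_le _ _).trans (by gcongr)
  have h4 : e c ≤ δ * ‖c‖ := (le_abs_self _).trans (e.le_of_opNorm_le hen c)
  have h5 := neg_le_of_abs_le hea
  have h6 : L c c = 2 * qL L c := by unfold qL; ring
  have h7 : L a₀ a₀ = 2 * qL L a₀ := by unfold qL; ring
  simp only [map_sub, sub_apply, add_apply, hL.2 a₀ c] at hs' h1 h2
  nlinarith

theorem statement14 [CompleteSpace B] [Nontrivial B]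
    (L : B →L[ℝ] (B →L[ℝ] ℝ)) (hL : IsSN L)
    (A : Submodule ℝ B) (hclosed : IsClosed (A : Set B))
    (hpos : LPositive L (A : Set B)) :
    RDense L (A : Set B) ↔
      ∀ p : B →L[ℝ] ℝ, (∀ a ∈ A, p a = 0) → sL L p ≤ 0 := by
  have hA : ∀ a ∈ A, 0 ≤ qL L a := fun a ha => by
    simpa using hpos.2 a ha 0 A.zero_mem
  exact ⟨fun hd _ hp => hd.sL_nonpos hL hA hp, rDense_of_sL_nonpos hL hA⟩
end
end

section
/- Let A be a closed monotone linear subspace of E × E*. Define the adjoint linear subspace A^T ⊆ E** × E* by: (y**, y*) ∈ A^T if and only if ⟨s, y*⟩ = ⟨s*, y**⟩ for all (s, s*) ∈ A. Say that A^T is monotone if ⟨y* − z*, y** − z**⟩ ≥ 0 for all (y**, y*), (z**, z*) ∈ A^T, and maximally monotone if A^T is monotone and is not properly contained in any subset of E** × E* that is monotone in this sense. Then the following are equivalent: (i) A is quasidense; (ii) A^T is monotone; (iii) A^T is maximally monotone. -/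
noncomputable section

open Filter Topology

variable {E : Type*} [NormedAddCommGroup E] [NormedSpace ℝ E]

/-- Monotonicity (in the sense of the pairing `⟨y* - z*, y** - z**⟩ ≥ 0`) for subsets of
`E** × E*`. -/
def MonotoneT (C : Set (((E →L[ℝ] ℝ) →L[ℝ] ℝ) × (E →L[ℝ] ℝ))) : Prop :=
  ∀ p ∈ C, ∀ q ∈ C, 0 ≤ (p.1 - q.1) (p.2 - q.2)

/-- The adjoint linear subspace `A^T ⊆ E** × E*` of `A ⊆ E × E*`. -/
def adjointSubspace (A : Set (E × (E →L[ℝ] ℝ))) :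
    Set (((E →L[ℝ] ℝ) →L[ℝ] ℝ) × (E →L[ℝ] ℝ)) :=
  {y | ∀ q ∈ A, y.2 q.1 = y.1 q.2}

/-- A convex continuous function `g` and a function `h` convex on `S` with `0 ≤ g + h` on `S` are
separated by a continuous affine function. -/
theorem exists_affine_between {X : Type*} [NormedAddCommGroup X] [NormedSpace ℝ X]
    {g h : X → ℝ} {S : Set X} (hg : ConvexOn ℝ Set.univ g) (hgc : Continuous g)
    (hh : ConvexOn ℝ S h) (hS : S.Nonempty) (hgh : ∀ x ∈ S, 0 ≤ g x + h x) :
    ∃ (φ : X →L[ℝ] ℝ) (β : ℝ), (∀ x, φ x + β ≤ g x) ∧ ∀ x ∈ S, -(φ x) - β ≤ h x := by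
  have hconv : Convex ℝ {y : X × ℝ | g y.1 < y.2} := by
    simpa using hg.convex_strict_epigraph
  have hopen : IsOpen {y : X × ℝ | g y.1 < y.2} :=
    isOpen_lt (hgc.comp continuous_fst) continuous_snd
  have hconv' : Convex ℝ {y : X × ℝ | y.1 ∈ S ∧ y.2 ≤ -h y.1} := by
    simpa using hh.neg.convex_hypograph
  have hdisj : Disjoint {y : X × ℝ | g y.1 < y.2} {y : X × ℝ | y.1 ∈ S ∧ y.2 ≤ -h y.1} := by
    rw [Set.disjoint_left]
    rintro ⟨x, r⟩ h1 ⟨h2, h3⟩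
    have := hgh x h2
    simp only [Set.mem_ofPred_eq] at h1 h3
    linarith
  obtain ⟨Φ, u, h1, h2⟩ := geometric_hahn_banach_open hconv hopen hconv' hdisj
  have hΦ : ∀ x r, Φ (x, r) = Φ (x, 0) + r * Φ (0, 1) := by
    intro x r
    rw [← smul_eq_mul, ← map_smul, ← map_add]
    simp
  set c := Φ (0, 1) with hc
  obtain ⟨x₀, hx₀⟩ := hS
  have hc0 : c < 0 := by
    have e1 := h1 (x₀, g x₀ + 1) (by simp)
    have e2 := h2 (x₀, -h x₀) ⟨hx₀, le_rfl⟩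
    rw [hΦ] at e1 e2
    have := hgh x₀ hx₀
    by_contra hcon
    push Not at hcon
    nlinarith
  have h1' : ∀ x, Φ (x, 0) + g x * c ≤ u := by
    intro x
    refine le_of_forall_pos_le_add fun ε hε => ?_
    have := h1 (x, g x + ε / (-c)) (by simpa using div_pos hε (neg_pos.mpr hc0))
    rw [hΦ] at this
    have e : (g x + ε / (-c)) * c = g x * c - ε := by
      rw [add_mul, div_neg, neg_mul, div_mul_cancel₀ _ hc0.ne, sub_eq_add_neg]
    linarith
  refine ⟨(-c⁻¹) • Φ.comp (ContinuousLinearMap.inl ℝ X ℝ), c⁻¹ * u, fun x => ?_, fun x hx => ?_⟩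
  · have := h1' x
    simp only [smul_apply, ContinuousLinearMap.comp_apply,
      ContinuousLinearMap.inl_apply, smul_eq_mul]
    have e : g x = c⁻¹ * (g x * c) := by
      rw [mul_comm, mul_inv_cancel_right₀ hc0.ne]
    rw [e]
    have : c⁻¹ < 0 := inv_lt_zero.mpr hc0
    nlinarith
  · have := h2 (x, -h x) ⟨hx, le_rfl⟩
    rw [hΦ] at this
    simp only [smul_apply, ContinuousLinearMap.comp_apply,
      ContinuousLinearMap.inl_apply, smul_eq_mul]
    have e : h x = c⁻¹ * (h x * c) := by
      rw [mul_comm, mul_inv_cancel_right₀ hc0.ne]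
    rw [e]
    have : c⁻¹ < 0 := inv_lt_zero.mpr hc0
    nlinarith

/-- The conjugate of half the squared norm dominates half the squared dual norm. -/
theorem half_sq_opNorm_le {X : Type*} [NormedAddCommGroup X] [NormedSpace ℝ X]
    (φ : X →L[ℝ] ℝ) {C : ℝ} (h : ∀ z, φ z ≤ (1 / 2) * ‖z‖ ^ 2 + C) :
    (1 / 2) * ‖φ‖ ^ 2 ≤ C := by
  have hC : 0 ≤ C := by simpa using h 0
  have : ‖φ‖ ≤ Real.sqrt (2 * C) := by
    refine φ.opNorm_le_bound (Real.sqrt_nonneg _) fun z => ?_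
    have hd : discrim ((1 / 2) * ‖z‖ ^ 2) (-φ z) C ≤ 0 := by
      refine discrim_le_zero fun t => ?_
      have := h (t • z)
      rw [map_smul, norm_smul, mul_pow, Real.norm_eq_abs, sq_abs, smul_eq_mul] at this
      nlinarith
    rw [discrim] at hd
    rw [Real.norm_eq_abs]
    refine abs_le_of_sq_le_sq ?_ (by positivity)
    rw [mul_pow, Real.sq_sqrt (by positivity)]
    nlinarith
  have h2 := pow_le_pow_left₀ (norm_nonneg _) this 2
  rw [Real.sq_sqrt (by positivity)] at h2
  linarith

/-- Approximate optimality conditions for minimizing `½‖z‖² + ⟨z, z*⟩ - ⟨z, d⟩` over a translate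
of a monotone subspace: the dual variable `(b₁, b₂)` does not depend on `ε`. -/
theorem exists_approx_optimality (A : Submodule ℝ (E × (E →L[ℝ] ℝ)))
    (hA : ∀ a ∈ A, 0 ≤ a.2 a.1) (p : E × (E →L[ℝ] ℝ)) (d₁ : E →L[ℝ] ℝ)
    (d₂ : (E →L[ℝ] ℝ) →L[ℝ] ℝ) :
    ∃ (b₁ : E →L[ℝ] ℝ) (b₂ : (E →L[ℝ] ℝ) →L[ℝ] ℝ), ∀ ε > 0, ∃ z : E × (E →L[ℝ] ℝ), z + p ∈ A ∧
      (1 / 2) * ‖z.1‖ ^ 2 + (1 / 2) * ‖z.2‖ ^ 2 + (1 / 2) * ‖b₁‖ ^ 2 + (1 / 2) * ‖b₂‖ ^ 2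
        ≤ b₁ z.1 + b₂ z.2 + ε ∧
      ∃ (w₁ : E →L[ℝ] ℝ) (w₂ : (E →L[ℝ] ℝ) →L[ℝ] ℝ), ‖w₁‖ ≤ ε ∧ ‖w₂‖ ≤ ε ∧
        ∀ a ∈ A, (b₁ + z.2 - w₁ - d₁) a.1 +
          (b₂ + NormedSpace.inclusionInDoubleDual ℝ E z.1 - w₂ - d₂) a.2 = 0 := by
  set S : Set (E × (E →L[ℝ] ℝ)) := {z | z + p ∈ A} with hSdef
  have hS : S.Nonempty := ⟨-p, by simp [hSdef]⟩
  set g : E × (E →L[ℝ] ℝ) → ℝ := fun z => (1 / 2) * ‖z.1‖ ^ 2 + (1 / 2) * ‖z.2‖ ^ 2 with hgdef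
  set k : E × (E →L[ℝ] ℝ) → ℝ := fun z => z.2 z.1 - d₁ z.1 - d₂ z.2 with hkdef
  have hbdd : BddBelow ((fun z => g z + k z) '' S) := by
    refine ⟨-(1 / 2) * (‖p.2‖ + ‖d₁‖) ^ 2 - (1 / 2) * (‖p.1‖ + ‖d₂‖) ^ 2 - p.2 p.1, ?_⟩
    rintro _ ⟨z, hz, rfl⟩
    have h0 := hA _ hz
    simp only [Prod.fst_add, Prod.snd_add, add_apply, map_add] at h0
    have h1 := (le_abs_self _).trans (p.2.le_opNorm z.1)
    have h2 := (le_abs_self _).trans (d₁.le_opNorm z.1)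
    have h3 := (le_abs_self _).trans (z.2.le_opNorm p.1)
    have h4 := (le_abs_self _).trans (d₂.le_opNorm z.2)
    simp only [hgdef, hkdef]
    nlinarith [sq_nonneg (‖z.1‖ - (‖p.2‖ + ‖d₁‖)), sq_nonneg (‖z.2‖ - (‖p.1‖ + ‖d₂‖))]
  set m := sInf ((fun z => g z + k z) '' S) with hm
  have hmle : ∀ z ∈ S, m ≤ g z + k z := fun z hz => csInf_le hbdd ⟨z, hz, rfl⟩
  have hgconv : ConvexOn ℝ Set.univ g := by
    have h1 : ConvexOn ℝ Set.univ fun x : E => ‖x‖ ^ 2 :=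
      convexOn_univ_norm.pow (fun _ _ => norm_nonneg _) 2
    have h2 : ConvexOn ℝ Set.univ fun x : E →L[ℝ] ℝ => ‖x‖ ^ 2 :=
      convexOn_univ_norm.pow (fun _ _ => norm_nonneg _) 2
    exact ((h1.comp_linearMap (LinearMap.fst ℝ _ _)).smul (by norm_num : (0 : ℝ) ≤ 1 / 2)).add
      ((h2.comp_linearMap (LinearMap.snd ℝ _ _)).smul (by norm_num : (0 : ℝ) ≤ 1 / 2))
  have hgcont : Continuous g := by fun_prop
  have hkconv : ConvexOn ℝ S fun z => k z - m := by
    refine ⟨?_, ?_⟩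
    · intro x hx y hy s t _ _ hst
      have : s • x + t • y + p = s • (x + p) + t • (y + p) := by
        have hp : p = (s + t) • p := by rw [hst, one_smul]
        nth_rewrite 1 [hp]
        module
      simp only [hSdef, Set.mem_ofPred_eq] at hx hy ⊢
      rw [this]
      exact A.add_mem (A.smul_mem _ hx) (A.smul_mem _ hy)
    · intro x hx y hy s t hs ht hst
      have hxy : x - y ∈ A := by
        have := A.sub_mem hx hy
        simpa using this
      have h0 := mul_nonneg (mul_nonneg hs ht) (hA _ hxy)
      obtain rfl : t = 1 - s := by linarith
      simp only [Prod.fst_sub, Prod.snd_sub, sub_apply, map_sub] at h0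
      simp only [hkdef, Prod.fst_add, Prod.snd_add, Prod.smul_fst, Prod.smul_snd,
        add_apply, smul_apply, map_add, map_smul,
        smul_eq_mul]
      nlinarith
  obtain ⟨φ, β, hφg, hφh⟩ := exists_affine_between hgconv hgcont hkconv hS
    (fun z hz => by linarith [hmle z hz])
  set b₁ := φ.comp (ContinuousLinearMap.inl ℝ E (E →L[ℝ] ℝ)) with hb₁
  set b₂ := φ.comp (ContinuousLinearMap.inr ℝ E (E →L[ℝ] ℝ)) with hb₂
  have hφ : ∀ z, φ z = b₁ z.1 + b₂ z.2 := by
    intro z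
    simp [hb₁, hb₂, ← map_add]
  have hβ : (1 / 2) * ‖b₁‖ ^ 2 + (1 / 2) * ‖b₂‖ ^ 2 ≤ -β := by
    have : (1 / 2) * ‖b₁‖ ^ 2 ≤ -β - (1 / 2) * ‖b₂‖ ^ 2 := by
      refine half_sq_opNorm_le b₁ fun x => ?_
      have : (1 / 2) * ‖b₂‖ ^ 2 ≤ -β + ((1 / 2) * ‖x‖ ^ 2 - b₁ x) := by
        refine half_sq_opNorm_le b₂ fun y => ?_
        have := hφg (x, y)
        rw [hφ] at this
        simp only [hgdef] at this
        linarith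
      linarith
    linarith
  refine ⟨b₁, b₂, fun ε hε => ?_⟩
  set δ := min ε ((ε / 2) ^ 2) with hδ
  have hδ0 : 0 < δ := by positivity
  obtain ⟨_, ⟨z, hz, rfl⟩, hlt⟩ := exists_lt_of_csInf_lt (hS.image _)
    (show sInf ((fun z => g z + k z) '' S) < m + δ by linarith)
  simp only at hlt
  refine ⟨z, hz, ?_, ?_⟩
  · have h1 := hφh z hz
    rw [hφ] at h1
    have h2 : δ ≤ ε := min_le_left _ _
    simp only [hgdef] at hlt
    linarith
  set ℓ : E × (E →L[ℝ] ℝ) →L[ℝ] ℝ :=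
    (b₁ + z.2 - d₁).comp (ContinuousLinearMap.fst ℝ E (E →L[ℝ] ℝ)) +
    (b₂ + NormedSpace.inclusionInDoubleDual ℝ E z.1 - d₂).comp
      (ContinuousLinearMap.snd ℝ E (E →L[ℝ] ℝ)) with hℓ
  have hℓv : ∀ v, ℓ v = (b₁ v.1 + z.2 v.1 - d₁ v.1) + (b₂ v.2 + v.2 z.1 - d₂ v.2) := by
    intro v
    simp [hℓ]
  have hquad : ∀ v ∈ A, 0 ≤ v.2 v.1 + ℓ v + δ := by
    intro v hv
    have hzv : z + v ∈ S := by
      have := A.add_mem hz hv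
      simp only [hSdef, Set.mem_ofPred_eq]
      rwa [add_right_comm] at this
    have h1 := hφh _ hzv
    have h2 := hφg z
    rw [hφ] at h1 h2
    simp only [hkdef, Prod.fst_add, Prod.snd_add, add_apply, map_add]
      at h1 hlt
    rw [hℓv]
    linarith
  have hbound : ∀ v ∈ A, |ℓ v| ≤ ε * ‖v‖ := by
    intro v hv
    have hd : discrim (v.2 v.1) (ℓ v) δ ≤ 0 := by
      refine discrim_le_zero fun t => ?_
      have := hquad _ (A.smul_mem t hv)
      simp only [Prod.smul_fst, Prod.smul_snd, smul_apply, map_smul,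
        smul_eq_mul] at this
      nlinarith
    rw [discrim] at hd
    have h1 : v.2 v.1 ≤ ‖v‖ ^ 2 := by
      refine (le_abs_self _).trans ((v.2.le_opNorm v.1).trans ?_)
      rw [sq]
      exact mul_le_mul (norm_snd_le v) (norm_fst_le v) (norm_nonneg _) (norm_nonneg _)
    have h2 : δ ≤ (ε / 2) ^ 2 := min_le_right _ _
    refine abs_le_of_sq_le_sq ?_ (by positivity)
    calc ℓ v ^ 2 ≤ 4 * (v.2 v.1 * δ) := by linarith
      _ ≤ 4 * (‖v‖ ^ 2 * (ε / 2) ^ 2) := by gcongr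
      _ = (ε * ‖v‖) ^ 2 := by ring
  obtain ⟨w, hw, hwn⟩ := exists_extension_norm_eq A (ℓ.comp A.subtypeL)
  have hwε : ‖w‖ ≤ ε := by
    rw [hwn]
    exact ContinuousLinearMap.opNorm_le_bound _ hε.le fun v => hbound v v.2
  refine ⟨w.comp (ContinuousLinearMap.inl ℝ _ _), w.comp (ContinuousLinearMap.inr ℝ _ _), ?_, ?_,
    fun a ha => ?_⟩
  · refine ContinuousLinearMap.opNorm_le_bound _ hε.le fun x => ?_
    simpa using w.le_of_opNorm_le hwε (x, 0)
  · refine ContinuousLinearMap.opNorm_le_bound _ hε.le fun x => ?_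
    simpa using w.le_of_opNorm_le hwε (0, x)
  · have h1 : w a = ℓ a := hw ⟨a, ha⟩
    have h2 : w a = w (a.1, 0) + w (0, a.2) := by simp [← map_add]
    rw [hℓv] at h1
    simp only [sub_apply, add_apply,
      ContinuousLinearMap.comp_apply, ContinuousLinearMap.inl_apply,
      ContinuousLinearMap.inr_apply, NormedSpace.dual_def]
    linarith

/-- If the duality pairing is nonpositive on the translate by `(d₁, d₂)` of the annihilator of `A`,
then the approximate minimizers have small energy. -/
theorem exists_approx_energy (A : Submodule ℝ (E × (E →L[ℝ] ℝ)))
    (hA : ∀ a ∈ A, 0 ≤ a.2 a.1) (p : E × (E →L[ℝ] ℝ)) (d₁ : E →L[ℝ] ℝ)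
    (d₂ : (E →L[ℝ] ℝ) →L[ℝ] ℝ)
    (hd : ∀ (e₁ : E →L[ℝ] ℝ) (e₂ : (E →L[ℝ] ℝ) →L[ℝ] ℝ), (∀ a ∈ A, e₁ a.1 + e₂ a.2 = 0) →
      (d₂ + e₂) (d₁ + e₁) ≤ 0) :
    ∃ (b₁ : E →L[ℝ] ℝ) (b₂ : (E →L[ℝ] ℝ) →L[ℝ] ℝ), ∀ ε > 0, ∃ z : E × (E →L[ℝ] ℝ), z + p ∈ A ∧
      (1 / 2) * ‖z.1‖ ^ 2 + (1 / 2) * ‖z.2‖ ^ 2 + (1 / 2) * ‖b₁‖ ^ 2 + (1 / 2) * ‖b₂‖ ^ 2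
        ≤ b₁ z.1 + b₂ z.2 + ε ∧
      (1 / 2) * ‖z.1‖ ^ 2 + (1 / 2) * ‖z.2‖ ^ 2 + z.2 z.1 ≤ ε ∧
      ∃ (w₁ : E →L[ℝ] ℝ) (w₂ : (E →L[ℝ] ℝ) →L[ℝ] ℝ), ‖w₁‖ ≤ ε ∧ ‖w₂‖ ≤ ε ∧
        ∀ a ∈ A, (b₁ + z.2 - w₁ - d₁) a.1 +
          (b₂ + NormedSpace.inclusionInDoubleDual ℝ E z.1 - w₂ - d₂) a.2 = 0 := by
  obtain ⟨b₁, b₂, hb⟩ := exists_approx_optimality A hA p d₁ d₂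
  refine ⟨b₁, b₂, fun ε hε => ?_⟩
  set M := 2 * ‖b₁‖ + 2 * ‖b₂‖ + 4 with hM
  have hM0 : 0 < M := by positivity
  set η := min (1 / 2) (ε / M) with hη
  have hη0 : 0 < η := by positivity
  have hη1 : η ≤ 1 / 2 := min_le_left _ _
  have hηM : η * M ≤ ε := (le_div_iff₀ hM0).mp (min_le_right _ _)
  have hηε : η ≤ ε := by nlinarith [norm_nonneg b₁, norm_nonneg b₂]
  obtain ⟨z, hz, hgap, w₁, w₂, hw₁, hw₂, hperp⟩ := hb η hη0
  refine ⟨z, hz, hgap.trans (by linarith), ?_, w₁, w₂, hw₁.trans hηε, hw₂.trans hηε, hperp⟩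
  have hneg := hd _ _ hperp
  have h1 := (le_abs_self _).trans (b₁.le_opNorm z.1)
  have h2 := (le_abs_self _).trans (b₂.le_opNorm z.2)
  have hz1 : ‖z.1‖ ≤ ‖b₁‖ + 1 := by
    nlinarith [sq_nonneg (‖z.1‖ - ‖b₁‖), sq_nonneg (‖z.2‖ - ‖b₂‖)]
  have hz2 : ‖z.2‖ ≤ ‖b₂‖ + 1 := by
    nlinarith [sq_nonneg (‖z.1‖ - ‖b₁‖), sq_nonneg (‖z.2‖ - ‖b₂‖)]
  have k1 : w₂ b₁ ≤ η * ‖b₁‖ := (le_abs_self _).trans (w₂.le_of_opNorm_le hw₂ _)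
  have k2 : w₂ z.2 ≤ η * ‖z.2‖ := (le_abs_self _).trans (w₂.le_of_opNorm_le hw₂ _)
  have k3 : w₁ z.1 ≤ η * ‖z.1‖ := (le_abs_self _).trans (w₁.le_of_opNorm_le hw₁ _)
  have k4 : b₂ w₁ ≤ ‖b₂‖ * η :=
    (le_abs_self _).trans ((b₂.le_opNorm _).trans (by gcongr))
  have k5 : -(w₂ w₁) ≤ η * η :=
    (neg_le_abs _).trans ((w₂.le_of_opNorm_le hw₂ _).trans (by gcongr))
  have k6 : -(b₂ b₁) ≤ ‖b₂‖ * ‖b₁‖ := (neg_le_abs _).trans (b₂.le_opNorm _)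
  simp only [add_sub_cancel, sub_apply, add_apply,
    map_add, map_sub, NormedSpace.dual_def] at hneg
  nlinarith [sq_nonneg (‖b₁‖ - ‖b₂‖)]

/-- A quasidense set is of negative infimum type with respect to `E** × E*`. -/
theorem Quasidense.exists_pairing_le {A : Set (E × (E →L[ℝ] ℝ))} (hA : Quasidense A)
    (y : E →L[ℝ] ℝ) (ψ : (E →L[ℝ] ℝ) →L[ℝ] ℝ) {ε : ℝ} (hε : 0 < ε) :
    ∃ a ∈ A, (a.2 - y) a.1 - ψ (a.2 - y) ≤ ε := by
  obtain ⟨x, hx⟩ : ∃ x, (1 / 2) * ‖x‖ ^ 2 + (1 / 2) * ‖ψ‖ ^ 2 - ψ x < ε / 2 := by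
    by_contra! hcon
    have := half_sq_opNorm_le ψ (C := (1 / 2) * ‖ψ‖ ^ 2 - ε / 2) fun z => by
      linarith [hcon z]
    linarith
  have hlt : (⨅ q ∈ A, ((rQ q (0, y + x) : ℝ) : EReal)) < ((ε / 2 : ℝ) : EReal) :=
    (hA _).trans_lt (by exact_mod_cast half_pos hε)
  simp only [iInf_lt_iff, EReal.coe_lt_coe_iff] at hlt
  obtain ⟨a, ha, hlt⟩ := hlt
  refine ⟨a, ha, ?_⟩
  have h1 := (le_abs_self _).trans (x.le_opNorm a.1)
  have h2 := (neg_le_abs _).trans (ψ.le_opNorm (a.2 - (y + x)))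
  simp only [rQ, sub_zero, sub_apply, add_apply]
    at hlt
  simp only [map_sub, map_add] at h2
  simp only [sub_apply, map_sub]
  nlinarith [sq_nonneg (‖x‖ - ‖a.1‖), sq_nonneg (‖ψ‖ - ‖a.2 - (y + x)‖)]

theorem quasidense_of_forall_exists_le {A : Set (E × (E →L[ℝ] ℝ))}
    (h : ∀ p, ∀ ε > 0, ∃ q ∈ A, rQ q p ≤ ε) : Quasidense A := by
  intro p
  by_contra! hcon
  obtain ⟨r, hr0, hr⟩ := EReal.lt_iff_exists_real_btwn.mp hcon
  obtain ⟨q, hq, hle⟩ := h p r (by exact_mod_cast hr0)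
  exact absurd (hr.trans_le (iInf₂_le q hq)) (not_lt.mpr (by exact_mod_cast hle))

theorem monotoneT_adjointSubspace_of_quasidense (A : Submodule ℝ (E × (E →L[ℝ] ℝ)))
    (hA : ∀ a ∈ A, 0 ≤ a.2 a.1) (hq : Quasidense (A : Set (E × (E →L[ℝ] ℝ)))) :
    MonotoneT (adjointSubspace (A : Set (E × (E →L[ℝ] ℝ)))) := by
  intro y hy y' hy'
  refine le_of_forall_pos_le_add fun ε hε => ?_
  obtain ⟨a, ha, hle⟩ := hq.exists_pairing_le (-(y.2 - y'.2)) (y.1 - y'.1) hε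
  have h1 := hy a ha
  have h2 := hy' a ha
  have h3 := hA a ha
  simp only [sub_apply, neg_apply, map_sub, map_neg]
    at hle ⊢
  linarith

theorem quasidense_of_monotoneT_adjointSubspace (A : Submodule ℝ (E × (E →L[ℝ] ℝ)))
    (hA : ∀ a ∈ A, 0 ≤ a.2 a.1)
    (hT : MonotoneT (adjointSubspace (A : Set (E × (E →L[ℝ] ℝ))))) :
    Quasidense (A : Set (E × (E →L[ℝ] ℝ))) := by
  refine quasidense_of_forall_exists_le fun p ε hε => ?_
  obtain ⟨b₁, b₂, hb⟩ := exists_approx_energy A hA p 0 0 fun e₁ e₂ he => by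
    have := hT (-e₂, e₁) (fun a ha => by
      have := he a ha
      simp only [neg_apply]
      linarith) 0 (fun a _ => by simp)
    simpa using this
  obtain ⟨z, hz, -, hle, -⟩ := hb ε hε
  exact ⟨z + p, hz, by simpa [rQ] using hle⟩

/-- A point monotonically related to the adjoint of a monotone subspace belongs to it. -/
theorem mem_adjointSubspace_of_monotonically_related (A : Submodule ℝ (E × (E →L[ℝ] ℝ)))
    (hA : ∀ a ∈ A, 0 ≤ a.2 a.1) (c : ((E →L[ℝ] ℝ) →L[ℝ] ℝ) × (E →L[ℝ] ℝ))
    (hc : ∀ y ∈ adjointSubspace (A : Set (E × (E →L[ℝ] ℝ))), 0 ≤ (c.1 - y.1) (c.2 - y.2)) :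
    c ∈ adjointSubspace (A : Set (E × (E →L[ℝ] ℝ))) := by
  obtain ⟨b₁, b₂, hb⟩ := exists_approx_energy A hA 0 (-c.2) c.1 fun e₁ e₂ he => by
    have := hc (-e₂, e₁) (fun a ha => by
      have := he a ha
      simp only [neg_apply]
      linarith)
    simp only [sub_apply, neg_apply, add_apply, map_sub, map_add, map_neg] at this ⊢
    linarith
  simp only [add_zero] at hb
  have hb0 : ‖b₁‖ ^ 2 + ‖b₂‖ ^ 2 ≤ 0 := by
    refine le_of_forall_pos_le_add fun ε hε => ?_
    obtain ⟨z, hz, hgap, hle, -⟩ := hb (ε / 8) (by positivity)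
    have h0 := hA z hz
    have h1 := (le_abs_self _).trans (b₁.le_opNorm z.1)
    have h2 := (le_abs_self _).trans (b₂.le_opNorm z.2)
    nlinarith [sq_nonneg (‖b₁‖ - 2 * ‖z.1‖), sq_nonneg (‖b₂‖ - 2 * ‖z.2‖)]
  have hb₁ : b₁ = 0 := by
    refine norm_eq_zero.mp ?_
    nlinarith [sq_nonneg ‖b₁‖, sq_nonneg ‖b₂‖]
  have hb₂ : b₂ = 0 := by
    refine (norm_eq_zero (a := b₂)).mp ?_
    nlinarith [sq_nonneg ‖b₁‖, sq_nonneg ‖b₂‖]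
  subst hb₁ hb₂
  intro a ha
  rw [← sub_eq_zero, ← abs_nonpos_iff]
  have hlim : ∀ η > 0, |c.2 a.1 - c.1 a.2| ≤ η * (3 * (‖a.1‖ + ‖a.2‖)) := by
    intro η hη
    set ε := min η (η ^ 2) with hε
    have hε0 : 0 < ε := by positivity
    have hεη : ε ≤ η := min_le_left _ _
    have hεη2 : ε ≤ η ^ 2 := min_le_right _ _
    obtain ⟨z, hz, -, hle, w₁, w₂, hw₁, hw₂, hperp⟩ := hb ε hε0
    have h0 := hA z hz
    have hz1 : ‖z.1‖ ≤ 2 * η :=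
      abs_le_of_sq_le_sq' (by nlinarith [sq_nonneg ‖z.2‖]) (by positivity) |>.2
    have hz2 : ‖z.2‖ ≤ 2 * η :=
      abs_le_of_sq_le_sq' (by nlinarith [sq_nonneg ‖z.1‖]) (by positivity) |>.2
    have k1 := abs_le.mp (w₁.le_of_opNorm_le (hw₁.trans hεη) a.1)
    have k2 := abs_le.mp (w₂.le_of_opNorm_le (hw₂.trans hεη) a.2)
    have k3 := abs_le.mp (z.2.le_of_opNorm_le hz2 a.1)
    have k4 := abs_le.mp ((a.2.le_opNorm z.1).trans
      (mul_le_mul_of_nonneg_left hz1 (norm_nonneg _)))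
    have h := hperp a ha
    simp only [zero_add, sub_apply, neg_apply,
      NormedSpace.dual_def] at h
    rw [abs_le]
    constructor <;> linarith [k1.1, k1.2, k2.1, k2.2, k3.1, k3.2, k4.1, k4.2]
  refine le_of_forall_pos_le_add fun r hr => ?_
  have hK : 0 < 3 * (‖a.1‖ + ‖a.2‖) + 1 := by positivity
  have h1 := hlim (r / (3 * (‖a.1‖ + ‖a.2‖) + 1)) (by positivity)
  have h2 : r / (3 * (‖a.1‖ + ‖a.2‖) + 1) * (3 * (‖a.1‖ + ‖a.2‖) + 1) = r := by field_simp
  have h3 : 0 < r / (3 * (‖a.1‖ + ‖a.2‖) + 1) := by positivity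
  linarith

theorem statement15 [CompleteSpace E] [Nontrivial E]
    (A : Submodule ℝ (E × (E →L[ℝ] ℝ))) (hclosed : IsClosed (A : Set (E × (E →L[ℝ] ℝ))))
    (hmono : MonotoneSet (A : Set (E × (E →L[ℝ] ℝ)))) :
    (Quasidense (A : Set (E × (E →L[ℝ] ℝ))) ↔
        MonotoneT (adjointSubspace (A : Set (E × (E →L[ℝ] ℝ))))) ∧
    (MonotoneT (adjointSubspace (A : Set (E × (E →L[ℝ] ℝ)))) ↔
      (MonotoneT (adjointSubspace (A : Set (E × (E →L[ℝ] ℝ)))) ∧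
        ∀ C : Set (((E →L[ℝ] ℝ) →L[ℝ] ℝ) × (E →L[ℝ] ℝ)), MonotoneT C →
          adjointSubspace (A : Set (E × (E →L[ℝ] ℝ))) ⊆ C →
          C = adjointSubspace (A : Set (E × (E →L[ℝ] ℝ))))) := by
  have hA : ∀ a ∈ A, 0 ≤ a.2 a.1 := fun a ha => by simpa using hmono.2 a ha 0 A.zero_mem
  refine ⟨⟨monotoneT_adjointSubspace_of_quasidense A hA,
    quasidense_of_monotoneT_adjointSubspace A hA⟩, fun hT => ⟨hT, fun C hC hsub => ?_⟩, And.left⟩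
  exact (Set.Subset.antisymm hsub fun c hc =>
    mem_adjointSubspace_of_monotonically_related A hA c fun y hy => hC c hc y (hsub hy)).symm
end
end

section
/- Let A be an L-positive subset of B, a ∈ A and b ∈ B. Then ‖a‖ ≤ √(2·r_L(a − b)) + (5/2)·dist(b, A) + ‖b‖, where dist(b, A) := inf_{c ∈ A} ‖b − c‖ (note that r_L(a − b) ≥ 0, so the square root is well defined). -/
noncomputable section

variable {B : Type*} [NormedAddCommGroup B] [NormedSpace ℝ B]

/-- For an `L`-positive set `A` and any point `b`, the distance from `b` to
a point `a` of `A` is controlled by `r_L (a - b)` and the distance from `b` to any other point. -/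
theorem LPositive.norm_sub_le {L : B →L[ℝ] (B →L[ℝ] ℝ)} (hL : IsSN L) {A : Set B}
    (hpos : LPositive L A) {a c : B} (ha : a ∈ A) (hc : c ∈ A) (b : B) :
    ‖a - b‖ ≤ Real.sqrt (2 * rL L (a - b)) + (5 / 2) * ‖b - c‖ := by
  have bound (x y : B) : L x y ≤ ‖x‖ * ‖y‖ := by
    have h := (le_abs_self _).trans (L.le_opNorm₂ x y)
    refine h.trans ?_
    rw [mul_assoc]
    exact mul_le_of_le_one_left (by positivity) hL.1
  have hq : 0 ≤ qL L (a - b) + L (a - b) (b - c) + qL L (b - c) := by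
    have h := hpos.2 a ha c hc
    rw [← sub_add_sub_cancel a b c] at h
    simp only [qL, map_add, add_apply] at h ⊢
    linarith [hL.2 (a - b) (b - c)]
  have hcross := bound (a - b) (b - c)
  have hself := bound (b - c) (b - c)
  have hr : ‖a - b‖ ^ 2 - 2 * ‖a - b‖ * ‖b - c‖ - ‖b - c‖ ^ 2 ≤ 2 * rL L (a - b) := by
    have hqc : qL L (b - c) = (1 / 2) * L (b - c) (b - c) := rfl
    rw [rL]
    linarith
  have hsq : 2 * rL L (a - b) ≤ Real.sqrt (2 * rL L (a - b)) ^ 2 :=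
    (Real.sqrt_le_left (Real.sqrt_nonneg _)).1 le_rfl
  have hd := norm_nonneg (b - c)
  have hs := Real.sqrt_nonneg (2 * rL L (a - b))
  set s := Real.sqrt (2 * rL L (a - b))
  suffices ‖a - b‖ - ‖b - c‖ ≤ s + (3 / 2) * ‖b - c‖ by linarith
  refine le_of_abs_le (abs_le_of_sq_le_sq ?_ (by positivity))
  nlinarith [mul_nonneg hs hd, sq_nonneg ‖b - c‖]

theorem statement19 [CompleteSpace B] [Nontrivial B]
    (L : B →L[ℝ] (B →L[ℝ] ℝ)) (hL : IsSN L)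
    (A : Set B) (hpos : LPositive L A) (a : B) (ha : a ∈ A) (b : B) :
    ‖a‖ ≤ Real.sqrt (2 * rL L (a - b)) + (5 / 2) * Metric.infDist b A + ‖b‖ := by
  have h : (2 / 5) * (‖a - b‖ - Real.sqrt (2 * rL L (a - b))) ≤ Metric.infDist b A := by
    refine (Metric.le_infDist hpos.1).2 fun c hc => ?_
    rw [dist_eq_norm]
    linarith [hpos.norm_sub_le hL ha hc b]
  linarith [norm_le_norm_sub_add a b]
end
end
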